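/- arXiv:2103.04079 — 2 statements merged into one kernel-verified Lean document; each statement's English description precedes it below -/
import Mathlib

section
/- For every n ≥ 1 and k ≥ 1, there exists a nondeterministic event-clock input-driven pushdown automaton with at most C·n states (for an absolute constant C independent of n and k), over an alphabet of size k + 5, with nk stack symbols and k atomic clock constraints referring only to symbol history clocks, such that every deterministic event-clock input-driven pushdown automaton recognizing the same set of timed strings has at least 2^{n²} states and at least (2^{n²} − 2n·2^{n(n−1)})·(2^k − 1) stack symbols. -/
/-- Classification of input symbols: left brackets (calls), right brackets
(returns) and neutral (internal) symbols. -/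
inductive SymbolKind : Type
  | call | ret | int
  deriving DecidableEq

/-- The event clocks over an alphabet `A`: symbol history clocks `◁a`,
symbol prediction clocks `▷a`, the stack history clock `◁s` and the
stack prediction clock `▷s`. -/
inductive Clock (A : Type) : Type
  | histS (a : A)
  | predS (a : A)
  | histStack
  | predStack

/-- Clock constraints: Boolean combinations of atomic constraints
`C ≤ τ` and `C ≥ τ` (with a trivial constraint `tt`). -/
inductive ClockConstraint (A : Type) : Type
  | tt
  | le (C : Clock A) (τ : ℝ)
  | ge (C : Clock A) (τ : ℝ)
  | and (φ ψ : ClockConstraint A)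
  | or (φ ψ : ClockConstraint A)
  | not (φ : ClockConstraint A)

/-- The atomic constraints occurring in a clock constraint. -/
def ClockConstraint.atoms {A : Type} : ClockConstraint A → Set (ClockConstraint A)
  | .tt => ∅
  | .le C τ => {ClockConstraint.le C τ}
  | .ge C τ => {ClockConstraint.ge C τ}
  | .and φ ψ => φ.atoms ∪ ψ.atoms
  | .or φ ψ => φ.atoms ∪ ψ.atoms
  | .not φ => φ.atoms

/-- The clocks referred to by a clock constraint. -/
def ClockConstraint.clocks {A : Type} : ClockConstraint A → Set (Clock A)
  | .tt => ∅
  | .le C _ => {C}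
  | .ge C _ => {C}
  | .and φ ψ => φ.clocks ∪ ψ.clocks
  | .or φ ψ => φ.clocks ∪ ψ.clocks
  | .not φ => φ.clocks

/-- A timed string: the (real) time stamps are strictly increasing. -/
def IsTimed {A : Type} (w : List (A × ℝ)) : Prop :=
  (w.map Prod.snd).Chain' (· < ·)

/-- Well-nested (balanced) strings: every bracket is matched inside. -/
inductive WellNested {A : Type} (lab : A → SymbolKind) : List A → Prop
  | nil : WellNested lab []
  | int {a : A} {u : List A} :
      lab a = SymbolKind.int → WellNested lab u → WellNested lab (a :: u)
  | wrap {a b : A} {u v : List A} :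
      lab a = SymbolKind.call → lab b = SymbolKind.ret →
      WellNested lab u → WellNested lab v → WellNested lab (a :: u ++ b :: v)

/-- Position `j` holds a left bracket matched by the right bracket at
position `i`: the interior is well-nested. -/
def Matches {A : Type} (lab : A → SymbolKind) (w : List (A × ℝ)) (j i : ℕ) : Prop :=
  j < i ∧ i < w.length ∧
  (∃ p : A × ℝ, w[j]? = some p ∧ lab p.1 = SymbolKind.call) ∧
  (∃ p : A × ℝ, w[i]? = some p ∧ lab p.1 = SymbolKind.ret) ∧
  WellNested lab (((w.map Prod.fst).drop (j + 1)).take (i - j - 1))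

/-- `ClockVal lab w i C v` : the clock `C` is defined at position `i`
of the timed string `w` and has value `v`. -/
def ClockVal {A : Type} (lab : A → SymbolKind) (w : List (A × ℝ)) (i : ℕ) :
    Clock A → ℝ → Prop
  | .histS a, v => ∃ (pi pj : A × ℝ) (j : ℕ), w[i]? = some pi ∧ j < i ∧
      w[j]? = some pj ∧ pj.1 = a ∧
      (∀ (j' : ℕ) (p' : A × ℝ), j < j' → j' < i → w[j']? = some p' → p'.1 ≠ a) ∧
      v = pi.2 - pj.2
  | .predS a, v => ∃ (pi pj : A × ℝ) (j : ℕ), w[i]? = some pi ∧ i < j ∧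
      w[j]? = some pj ∧ pj.1 = a ∧
      (∀ (j' : ℕ) (p' : A × ℝ), i < j' → j' < j → w[j']? = some p' → p'.1 ≠ a) ∧
      v = pj.2 - pi.2
  | .histStack, v => ∃ (pi pj : A × ℝ) (j : ℕ), Matches lab w j i ∧
      w[i]? = some pi ∧ w[j]? = some pj ∧ v = pi.2 - pj.2
  | .predStack, v => ∃ (pi pj : A × ℝ) (j : ℕ), Matches lab w i j ∧
      w[i]? = some pi ∧ w[j]? = some pj ∧ v = pj.2 - pi.2

/-- Truth of a clock constraint at position `i` of the timed string `w`;
an atomic constraint is true only if the clock value is defined. -/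
def Sat {A : Type} (lab : A → SymbolKind) (w : List (A × ℝ)) (i : ℕ) :
    ClockConstraint A → Prop
  | .tt => True
  | .le C τ => ∃ v, ClockVal lab w i C v ∧ v ≤ τ
  | .ge C τ => ∃ v, ClockVal lab w i C v ∧ τ ≤ v
  | .and φ ψ => Sat lab w i φ ∧ Sat lab w i ψ
  | .or φ ψ => Sat lab w i φ ∨ Sat lab w i ψ
  | .not φ => ¬ Sat lab w i φ

/-- A nondeterministic event-clock input-driven pushdown automaton
(ECIDPDA) with states `Q` and stack alphabet `Γ`. -/
structure ECIDPDA (A Q Γ : Type) where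
  init : Set Q
  final : Set Q
  δint : A → Q → ClockConstraint A → Set Q
  δcall : A → Q → ClockConstraint A → Set (Q × Γ)
  δret : A → Option Γ → Q → ClockConstraint A → Set Q

/-- Configurations reachable after reading the first `i` symbols of the
timed string `w` (starting in an initial state with the empty stack);
each transition is guarded by a clock constraint which must be true at
the corresponding position. -/
inductive Reach {A Q Γ : Type} (lab : A → SymbolKind) (M : ECIDPDA A Q Γ)
    (w : List (A × ℝ)) : ℕ → Q × List Γ → Prop
  | start {q : Q} : q ∈ M.init → Reach lab M w 0 (q, [])
  | int {i : ℕ} {q q' : Q} {γ : List Γ} {p : A × ℝ} {φ : ClockConstraint A} :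
      Reach lab M w i (q, γ) → w[i]? = some p → lab p.1 = SymbolKind.int →
      Sat lab w i φ → q' ∈ M.δint p.1 q φ → Reach lab M w (i + 1) (q', γ)
  | call {i : ℕ} {q q' : Q} {γ : List Γ} {s : Γ} {p : A × ℝ} {φ : ClockConstraint A} :
      Reach lab M w i (q, γ) → w[i]? = some p → lab p.1 = SymbolKind.call →
      Sat lab w i φ → (q', s) ∈ M.δcall p.1 q φ → Reach lab M w (i + 1) (q', s :: γ)
  | ret {i : ℕ} {q q' : Q} {γ : List Γ} {s : Γ} {p : A × ℝ} {φ : ClockConstraint A} :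
      Reach lab M w i (q, s :: γ) → w[i]? = some p → lab p.1 = SymbolKind.ret →
      Sat lab w i φ → q' ∈ M.δret p.1 (some s) q φ → Reach lab M w (i + 1) (q', γ)
  | retEmpty {i : ℕ} {q q' : Q} {p : A × ℝ} {φ : ClockConstraint A} :
      Reach lab M w i (q, []) → w[i]? = some p → lab p.1 = SymbolKind.ret →
      Sat lab w i φ → q' ∈ M.δret p.1 none q φ → Reach lab M w (i + 1) (q', [])

/-- Acceptance: some computation reads the whole string and ends in an
accepting state, with any stack contents. -/
def ECIDPDA.Accepts {A Q Γ : Type} (lab : A → SymbolKind) (M : ECIDPDA A Q Γ)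
    (w : List (A × ℝ)) : Prop :=
  ∃ (q : Q) (γ : List Γ), Reach lab M w w.length (q, γ) ∧ q ∈ M.final

/-- The clock constraints actually used (guarding some transition). -/
def ECIDPDA.used {A Q Γ : Type} (M : ECIDPDA A Q Γ) : Set (ClockConstraint A) :=
  {φ | (∃ a q, (M.δint a q φ).Nonempty) ∨ (∃ a q, (M.δcall a q φ).Nonempty) ∨
       (∃ a s q, (M.δret a s q φ).Nonempty)}

/-- The set of atomic constraints occurring in the constraints used in
the transitions. -/
def ECIDPDA.atomicSet {A Q Γ : Type} (M : ECIDPDA A Q Γ) : Set (ClockConstraint A) :=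
  ⋃ φ ∈ M.used, φ.atoms

/-- Determinism: one initial state, at most one transition per clock
constraint, and distinct constraints guarding transitions from the same
state (and popped symbol) are never simultaneously true at any position
of any timed string. -/
def ECIDPDA.Deterministic {A Q Γ : Type} (lab : A → SymbolKind)
    (M : ECIDPDA A Q Γ) : Prop :=
  (∃ q₀ : Q, M.init = {q₀}) ∧
  (∀ a q φ, (M.δint a q φ).Subsingleton) ∧
  (∀ a q φ, (M.δcall a q φ).Subsingleton) ∧
  (∀ a s q φ, (M.δret a s q φ).Subsingleton) ∧
  (∀ a q φ φ', φ ≠ φ' → (M.δint a q φ).Nonempty → (M.δint a q φ').Nonempty →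
    ∀ (w : List (A × ℝ)) (i : ℕ), IsTimed w → i < w.length →
      ¬ (Sat lab w i φ ∧ Sat lab w i φ')) ∧
  (∀ a q φ φ', φ ≠ φ' → (M.δcall a q φ).Nonempty → (M.δcall a q φ').Nonempty →
    ∀ (w : List (A × ℝ)) (i : ℕ), IsTimed w → i < w.length →
      ¬ (Sat lab w i φ ∧ Sat lab w i φ')) ∧
  (∀ a s q φ φ', φ ≠ φ' → (M.δret a s q φ).Nonempty → (M.δret a s q φ').Nonempty →
    ∀ (w : List (A × ℝ)) (i : ℕ), IsTimed w → i < w.length →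
      ¬ (Sat lab w i φ ∧ Sat lab w i φ'))

namespace ECIDPDALowerBound

section TimedStrings

variable {A : Type} {lab : A → SymbolKind}

/-- The timed string with letters `l` whose position `i` carries the time stamp `i`. -/
def timed (l : List A) : List (A × ℝ) := l.mapIdx fun i a => (a, (i : ℝ))

theorem timed_getElem? (l : List A) (i : ℕ) :
    (timed l)[i]? = l[i]?.map fun a => (a, (i : ℝ)) := by
  simp [timed]

theorem length_timed (l : List A) : (timed l).length = l.length := by
  simp [timed]

theorem map_fst_timed (l : List A) : (timed l).map Prod.fst = l := by
  apply List.ext_getElem?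
  intro i
  rw [List.getElem?_map, timed_getElem?]
  cases l[i]? <;> simp

theorem isTimed_timed (l : List A) : IsTimed (timed l) := by
  unfold IsTimed
  refine List.isChain_iff_getElem.2 fun i hi => ?_
  simp [timed]

/-- `j` is the last position before `i` holding the letter `a`. -/
def LastOcc (l : List A) (i : ℕ) (a : A) (j : ℕ) : Prop :=
  j < i ∧ l[j]? = some a ∧ ∀ j', j < j' → j' < i → l[j']? ≠ some a

/-- `j` is the first position after `i` holding the letter `a`. -/
def NextOcc (l : List A) (i : ℕ) (a : A) (j : ℕ) : Prop :=
  i < j ∧ l[j]? = some a ∧ ∀ j', i < j' → j' < j → l[j']? ≠ some a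

theorem clockVal_histS_timed (l : List A) (i : ℕ) (a : A) (v : ℝ) :
    ClockVal lab (timed l) i (.histS a) v ↔
      i < l.length ∧ ∃ j, LastOcc l i a j ∧ v = (i : ℝ) - j := by
  constructor
  · rintro ⟨pi, pj, j, hi, hji, hj, rfl, h, rfl⟩
    simp only [timed_getElem?, Option.map_eq_some_iff] at hi hj
    obtain ⟨x, hx, rfl⟩ := hi
    obtain ⟨y, hy, rfl⟩ := hj
    refine ⟨(List.getElem?_eq_some_iff.1 hx).1, j, ⟨hji, hy, fun j' h1 h2 h3 => ?_⟩, rfl⟩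
    exact h j' (y, (j' : ℝ)) h1 h2 (by simp [timed_getElem?, h3]) rfl
  · rintro ⟨hi, j, ⟨hji, hj, h⟩, rfl⟩
    refine ⟨(l[i], (i : ℝ)), (a, (j : ℝ)), j, by simp [timed_getElem?, hi], hji,
      by simp [timed_getElem?, hj], rfl, fun j' p' h1 h2 h3 h4 => ?_, rfl⟩
    simp only [timed_getElem?, Option.map_eq_some_iff] at h3
    obtain ⟨x, hx, rfl⟩ := h3
    exact h j' h1 h2 (by simpa [hx] using h4)

theorem clockVal_predS_timed (l : List A) (i : ℕ) (a : A) (v : ℝ) :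
    ClockVal lab (timed l) i (.predS a) v ↔
      i < l.length ∧ ∃ j, NextOcc l i a j ∧ v = (j : ℝ) - i := by
  constructor
  · rintro ⟨pi, pj, j, hi, hji, hj, rfl, h, rfl⟩
    simp only [timed_getElem?, Option.map_eq_some_iff] at hi hj
    obtain ⟨x, hx, rfl⟩ := hi
    obtain ⟨y, hy, rfl⟩ := hj
    refine ⟨(List.getElem?_eq_some_iff.1 hx).1, j, ⟨hji, hy, fun j' h1 h2 h3 => ?_⟩, rfl⟩
    exact h j' (y, (j' : ℝ)) h1 h2 (by simp [timed_getElem?, h3]) rfl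
  · rintro ⟨hi, j, ⟨hji, hj, h⟩, rfl⟩
    refine ⟨(l[i], (i : ℝ)), (a, (j : ℝ)), j, by simp [timed_getElem?, hi], hji,
      by simp [timed_getElem?, hj], rfl, fun j' p' h1 h2 h3 h4 => ?_, rfl⟩
    simp only [timed_getElem?, Option.map_eq_some_iff] at h3
    obtain ⟨x, hx, rfl⟩ := h3
    exact h j' h1 h2 (by simpa [hx] using h4)

theorem wellNested_of_map_eq {u u' : List A} (h : WellNested lab u)
    (hu : u'.map lab = u.map lab) : WellNested lab u' := by
  induction h generalizing u' with
  | nil => simp at hu; subst hu; exact .nil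
  | int ha _ ih =>
    cases u' with
    | nil => simp at hu
    | cons b u' =>
      simp only [List.map_cons, List.cons.injEq] at hu
      exact .int (hu.1.trans ha) (ih hu.2)
  | @wrap a b u v ha hb _ _ ihu ihv =>
    cases u' with
    | nil => simp at hu
    | cons c u' =>
      simp only [List.cons_append, List.map_cons, List.cons.injEq, List.map_append] at hu
      obtain ⟨x, y, rfl, hx, hy⟩ := List.map_eq_append_iff.1 hu.2
      cases y with
      | nil => simp at hy
      | cons d y =>
        simp only [List.map_cons, List.cons.injEq] at hy
        exact .wrap (hu.1.trans ha) (hy.1.trans hb) (ihu hx) (ihv hy.2)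

theorem exists_timed_lab_iff (l : List A) (i : ℕ) (κ : SymbolKind) :
    (∃ p : A × ℝ, (timed l)[i]? = some p ∧ lab p.1 = κ) ↔ (l.map lab)[i]? = some κ := by
  rw [timed_getElem?, List.getElem?_map]
  cases l[i]? <;> simp

theorem matches_timed_mono {l l' : List A} (h : l.map lab = l'.map lab) {j i : ℕ}
    (hm : Matches lab (timed l) j i) : Matches lab (timed l') j i := by
  obtain ⟨h1, h2, h3, h4, h5⟩ := hm
  have hlen : l.length = l'.length := by simpa using congrArg List.length h
  rw [exists_timed_lab_iff] at h3 h4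
  refine ⟨h1, by rwa [length_timed, ← hlen, ← length_timed l], ?_, ?_, ?_⟩
  · rwa [exists_timed_lab_iff, ← h]
  · rwa [exists_timed_lab_iff, ← h]
  · rw [map_fst_timed] at h5 ⊢
    refine wellNested_of_map_eq h5 ?_
    rw [List.map_take, List.map_drop, List.map_take, List.map_drop, h]

theorem clockVal_stack_mono {l l' : List A} (h : l.map lab = l'.map lab) {i : ℕ} {v : ℝ} :
    (ClockVal lab (timed l) i .histStack v → ClockVal lab (timed l') i .histStack v) ∧
    (ClockVal lab (timed l) i .predStack v → ClockVal lab (timed l') i .predStack v) := by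
  have hlen : l.length = l'.length := by simpa using congrArg List.length h
  have key : ∀ {i : ℕ} {p : A × ℝ}, (timed l)[i]? = some p →
      ∃ p', (timed l')[i]? = some p' ∧ p'.2 = p.2 := by
    intro i p hp
    simp only [timed_getElem?, Option.map_eq_some_iff] at hp
    obtain ⟨x, hx, rfl⟩ := hp
    have hi : i < l'.length := hlen ▸ (List.getElem?_eq_some_iff.1 hx).1
    exact ⟨(l'[i], (i : ℝ)), by simp [timed_getElem?, hi], rfl⟩
  constructor
  all_goals
    rintro ⟨pi, pj, j, hm, hi, hj, rfl⟩
    obtain ⟨pi', hi', ei⟩ := key hi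
    obtain ⟨pj', hj', ej⟩ := key hj
    exact ⟨pi', pj', j, matches_timed_mono h hm, hi', hj', by rw [ei, ej]⟩

theorem sat_timed_congr {l l' : List A} (h : l.map lab = l'.map lab) {i : ℕ}
    (hlast : ∀ a j, LastOcc l i a j ↔ LastOcc l' i a j)
    (hnext : ∀ a j, NextOcc l i a j ↔ NextOcc l' i a j) (φ : ClockConstraint A) :
    Sat lab (timed l) i φ ↔ Sat lab (timed l') i φ := by
  have hlen : l.length = l'.length := by simpa using congrArg List.length h
  have hC : ∀ C v, ClockVal lab (timed l) i C v ↔ ClockVal lab (timed l') i C v := by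
    intro C v
    cases C with
    | histS a => simp only [clockVal_histS_timed, hlast, hlen]
    | predS a => simp only [clockVal_predS_timed, hnext, hlen]
    | histStack => exact ⟨(clockVal_stack_mono h).1, (clockVal_stack_mono h.symm).1⟩
    | predStack => exact ⟨(clockVal_stack_mono h).2, (clockVal_stack_mono h.symm).2⟩
  induction φ with
  | tt => rfl
  | le C τ => simp only [Sat, hC]
  | ge C τ => simp only [Sat, hC]
  | and φ ψ ihφ ihψ => simp only [Sat, ihφ, ihψ]
  | or φ ψ ihφ ihψ => simp only [Sat, ihφ, ihψ]
  | not φ ih => simp only [Sat, ih]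

theorem exists_lastOcc {l : List A} {a : A} {i j : ℕ} (hji : j < i) (hj : l[j]? = some a) :
    ∃ j', j ≤ j' ∧ LastOcc l i a j' := by
  induction i with
  | zero => omega
  | succ i ih =>
    by_cases hi : l[i]? = some a
    · exact ⟨i, by omega, by omega, hi, fun j' _ _ => by omega⟩
    · have hne : j ≠ i := fun e => hi (e ▸ hj)
      obtain ⟨j', h1, h2, h3, h4⟩ := ih (by omega)
      refine ⟨j', h1, by omega, h3, fun m hm1 hm2 => ?_⟩
      rcases Nat.lt_succ_iff_lt_or_eq.1 hm2 with hm | rfl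
      · exact h4 m hm1 hm
      · exact hi

theorem LastOcc.congr_of_iff {l l' : List A} {i : ℕ} {a : A}
    (h : ∀ j < i, l[j]? = some a ↔ l'[j]? = some a) (j : ℕ) :
    LastOcc l i a j ↔ LastOcc l' i a j := by
  unfold LastOcc
  refine and_congr_right fun hj => ?_
  rw [h j hj]
  refine and_congr_right fun _ => forall_congr' fun j' => imp_congr_right fun _ =>
    forall_congr' fun h2 => ?_
  rw [ne_eq, ne_eq, h j' h2]

theorem NextOcc.congr_of_iff {l l' : List A} {i : ℕ} {a : A}
    (h : ∀ j, i < j → (l[j]? = some a ↔ l'[j]? = some a)) (j : ℕ) :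
    NextOcc l i a j ↔ NextOcc l' i a j := by
  unfold NextOcc
  refine and_congr_right fun hj => ?_
  rw [h j hj]
  refine and_congr_right fun _ => forall_congr' fun j' => forall_congr' fun h1 =>
    imp_congr_right fun _ => ?_
  rw [ne_eq, ne_eq, h j' h1]

theorem LastOcc.congr_of_mem {l l' : List A} {i s j₀ : ℕ} {a : A}
    (h : ∀ j, s ≤ j → l[j]? = l'[j]?) (hs : s ≤ j₀) (hi : j₀ < i) (ha : l[j₀]? = some a) (j : ℕ) :
    LastOcc l i a j ↔ LastOcc l' i a j := by
  have ha' : l'[j₀]? = some a := h j₀ hs ▸ ha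
  constructor
  · rintro ⟨h1, h2, h3⟩
    have hj : j₀ ≤ j := not_lt.1 fun hlt => h3 j₀ hlt hi ha
    exact ⟨h1, h j (by omega) ▸ h2, fun j' h4 h5 => h j' (by omega) ▸ h3 j' h4 h5⟩
  · rintro ⟨h1, h2, h3⟩
    have hj : j₀ ≤ j := not_lt.1 fun hlt => h3 j₀ hlt hi ha'
    exact ⟨h1, h j (by omega) ▸ h2, fun j' h4 h5 => h j' (by omega) ▸ h3 j' h4 h5⟩

theorem NextOcc.congr_of_mem {l l' : List A} {i e j₀ : ℕ} {a : A}
    (h : ∀ j, j < e → l[j]? = l'[j]?) (hi : i < j₀) (he : j₀ < e) (ha : l[j₀]? = some a) (j : ℕ) :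
    NextOcc l i a j ↔ NextOcc l' i a j := by
  have ha' : l'[j₀]? = some a := h j₀ he ▸ ha
  constructor
  · rintro ⟨h1, h2, h3⟩
    have hj : j ≤ j₀ := not_lt.1 fun hlt => h3 j₀ hi hlt ha
    exact ⟨h1, h j (by omega) ▸ h2, fun m h4 h5 => h m (by omega) ▸ h3 m h4 h5⟩
  · rintro ⟨h1, h2, h3⟩
    have hj : j ≤ j₀ := not_lt.1 fun hlt => h3 j₀ hi hlt ha'
    exact ⟨h1, h j (by omega) ▸ h2, fun m h4 h5 => h m (by omega) ▸ h3 m h4 h5⟩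

/-- There is at most one left bracket and at most one right bracket. -/
def UniqueBrackets (lab : A → SymbolKind) : Prop :=
  ∀ a b, lab a = lab b → lab a ≠ .int → a = b

theorem getElem?_eq_some_iff_of_bracket {l l' : List A} (hu : UniqueBrackets lab)
    (h : l.map lab = l'.map lab) {a : A} (ha : lab a ≠ .int) (j : ℕ) :
    l[j]? = some a ↔ l'[j]? = some a := by
  have aux : ∀ {l l' : List A}, l.map lab = l'.map lab → l[j]? = some a → l'[j]? = some a := by
    intro l l' h hl
    have h2 : (l'.map lab)[j]? = some (lab a) := by rw [← h, List.getElem?_map, hl]; rfl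
    rw [List.getElem?_map, Option.map_eq_some_iff] at h2
    obtain ⟨b, hb, hab⟩ := h2
    rw [hb, hu b a hab (hab ▸ ha)]
  exact ⟨aux h, aux h.symm⟩

theorem exists_getElem?_pad {P : List A} (u v : List A) {a : A} (ha : a ∈ P) :
    ∃ j, u.length ≤ j ∧ j < u.length + P.length ∧ (u ++ (P ++ v))[j]? = some a := by
  obtain ⟨m, hm, rfl⟩ := List.getElem_of_mem ha
  exact ⟨u.length + m, by omega, by omega, by simp [List.getElem?_append, hm]⟩

/-- Behind a pad containing all neutral letters, the rest of the string is invisible to the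
clocks at earlier positions. -/
theorem sat_congr_left {P : List A} (hu : UniqueBrackets lab) (hP : ∀ a, lab a = .int → a ∈ P)
    {u v v' : List A} (h : v.map lab = v'.map lab) {i : ℕ} (hi : i < u.length)
    (φ : ClockConstraint A) :
    Sat lab (timed (u ++ (P ++ v))) i φ ↔ Sat lab (timed (u ++ (P ++ v'))) i φ := by
  have hl : (u ++ (P ++ v)).map lab = (u ++ (P ++ v')).map lab := by simp [h]
  have hag : ∀ j, j < u.length + P.length → (u ++ (P ++ v))[j]? = (u ++ (P ++ v'))[j]? := by
    intro j hj
    have hj' : j < (u ++ P).length := by simpa using hj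
    rw [← List.append_assoc, ← List.append_assoc, List.getElem?_append_left hj',
      List.getElem?_append_left hj']
  refine sat_timed_congr hl (fun a j => ?_) (fun a j => ?_) φ
  · exact LastOcc.congr_of_iff (fun j hj => by rw [hag j (by omega)]) j
  · by_cases ha : lab a = .int
    · obtain ⟨j₀, h1, h2, h3⟩ := exists_getElem?_pad u v (hP a ha)
      exact NextOcc.congr_of_mem hag (by omega) h2 h3 j
    · exact NextOcc.congr_of_iff (fun j _ => getElem?_eq_some_iff_of_bracket hu hl ha j) j

/-- In front of a pad containing all neutral letters, the beginning of the string is invisible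
to the clocks at later positions. -/
theorem sat_congr_right {P : List A} (hu : UniqueBrackets lab) (hP : ∀ a, lab a = .int → a ∈ P)
    {u u' v : List A} (h : u.map lab = u'.map lab) {i : ℕ} (hi : u.length + P.length ≤ i)
    (φ : ClockConstraint A) :
    Sat lab (timed (u ++ (P ++ v))) i φ ↔ Sat lab (timed (u' ++ (P ++ v))) i φ := by
  have hl : (u ++ (P ++ v)).map lab = (u' ++ (P ++ v)).map lab := by simp [h]
  have hlen : u.length = u'.length := by simpa using congrArg List.length h
  have hag : ∀ j, u.length ≤ j → (u ++ (P ++ v))[j]? = (u' ++ (P ++ v))[j]? := by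
    intro j hj
    rw [List.getElem?_append_right hj, List.getElem?_append_right (l₁ := u') (hlen ▸ hj), hlen]
  refine sat_timed_congr hl (fun a j => ?_) (fun a j => ?_) φ
  · by_cases ha : lab a = .int
    · obtain ⟨j₀, h1, h2, h3⟩ := exists_getElem?_pad u v (hP a ha)
      exact LastOcc.congr_of_mem hag h1 (by omega) h3 j
    · exact LastOcc.congr_of_iff (fun j _ => getElem?_eq_some_iff_of_bracket hu hl ha j) j
  · exact NextOcc.congr_of_iff (fun j hj => by rw [hag j (by omega)]) j

end TimedStrings

section Runs

variable {A Q Γ : Type} {lab : A → SymbolKind} {M : ECIDPDA A Q Γ} {w w' : List (A × ℝ)}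

theorem reach_zero_iff {c : Q × List Γ} :
    Reach lab M w 0 c ↔ c.1 ∈ M.init ∧ c.2 = [] := by
  constructor
  · rintro ⟨⟩
    exact ⟨by assumption, rfl⟩
  · obtain ⟨q, γ⟩ := c
    rintro ⟨h, rfl⟩
    exact .start h

theorem reach_succ_iff {i : ℕ} {c : Q × List Γ} :
    Reach lab M w (i + 1) c ↔ ∃ q γ p φ, Reach lab M w i (q, γ) ∧ w[i]? = some p ∧
      Sat lab w i φ ∧
      ((lab p.1 = .int ∧ c.1 ∈ M.δint p.1 q φ ∧ c.2 = γ) ∨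
       (lab p.1 = .call ∧ ∃ s, (c.1, s) ∈ M.δcall p.1 q φ ∧ c.2 = s :: γ) ∨
       (lab p.1 = .ret ∧ ∃ s, c.1 ∈ M.δret p.1 (some s) q φ ∧ γ = s :: c.2) ∨
       (lab p.1 = .ret ∧ c.1 ∈ M.δret p.1 none q φ ∧ γ = [] ∧ c.2 = [])) := by
  constructor
  · intro h
    cases h with
    | int h1 h2 h3 h4 h5 => exact ⟨_, _, _, _, h1, h2, h4, .inl ⟨h3, h5, rfl⟩⟩
    | call h1 h2 h3 h4 h5 => exact ⟨_, _, _, _, h1, h2, h4, .inr (.inl ⟨h3, _, h5, rfl⟩)⟩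
    | ret h1 h2 h3 h4 h5 => exact ⟨_, _, _, _, h1, h2, h4, .inr (.inr (.inl ⟨h3, _, h5, rfl⟩))⟩
    | retEmpty h1 h2 h3 h4 h5 =>
      exact ⟨_, _, _, _, h1, h2, h4, .inr (.inr (.inr ⟨h3, h5, rfl, rfl⟩))⟩
  · obtain ⟨q', γ'⟩ := c
    rintro ⟨q, γ, p, φ, h1, h2, h4, ⟨h3, h5, rfl⟩ | ⟨h3, s, h5, rfl⟩ | ⟨h3, s, h5, rfl⟩ |
      ⟨h3, h5, rfl, rfl⟩⟩
    · exact .int h1 h2 h3 h4 h5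
    · exact .call h1 h2 h3 h4 h5
    · exact .ret h1 h2 h3 h4 h5
    · exact .retEmpty h1 h2 h3 h4 h5

theorem exists_reach_of_le {i j : ℕ} (hij : i ≤ j) {c : Q × List Γ} (h : Reach lab M w j c) :
    ∃ c', Reach lab M w i c' := by
  induction j generalizing c with
  | zero => exact ⟨c, Nat.le_zero.1 hij ▸ h⟩
  | succ j ih =>
    rcases Nat.le_succ_iff.1 hij with hle | rfl
    · obtain ⟨q, γ, _, _, h1, _⟩ := reach_succ_iff.1 h
      exact ih hle h1
    · exact ⟨c, h⟩

theorem Reach.unique (hM : M.Deterministic lab) (hw : IsTimed w) {i : ℕ} {c c' : Q × List Γ}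
    (h : Reach lab M w i c) (h' : Reach lab M w i c') : c = c' := by
  obtain ⟨⟨q₀, hq₀⟩, sint, scall, sret, dint, dcall, dret⟩ := hM
  induction i generalizing c c' with
  | zero =>
    rw [reach_zero_iff, hq₀] at h h'
    exact Prod.ext (h.1.trans h'.1.symm) (h.2.trans h'.2.symm)
  | succ i ih =>
    obtain ⟨q, γ, p, φ, h1, h2, h3, h4⟩ := reach_succ_iff.1 h
    obtain ⟨q', γ', p', φ', h1', h2', h3', h4'⟩ := reach_succ_iff.1 h'
    obtain ⟨rfl, rfl⟩ := Prod.mk.inj (ih h1 h1')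
    obtain rfl : p = p' := Option.some.inj (h2.symm.trans h2')
    have hi : i < w.length := (List.getElem?_eq_some_iff.1 h2).1
    rcases h4 with ⟨k, m, e⟩ | ⟨k, s, m, e⟩ | ⟨k, s, m, e⟩ | ⟨k, m, e, e2⟩ <;>
    rcases h4' with ⟨k', m', e'⟩ | ⟨k', s', m', e'⟩ | ⟨k', s', m', e'⟩ | ⟨k', m', e', e2'⟩ <;>
    first
    | exact absurd (k.symm.trans k') (by decide)
    | skip
    · obtain rfl : φ = φ' := by
        by_contra hne
        exact dint _ _ _ _ hne ⟨_, m⟩ ⟨_, m'⟩ w i hw hi ⟨h3, h3'⟩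
      exact Prod.ext (sint _ _ _ m m') (e.trans e'.symm)
    · obtain rfl : φ = φ' := by
        by_contra hne
        exact dcall _ _ _ _ hne ⟨_, m⟩ ⟨_, m'⟩ w i hw hi ⟨h3, h3'⟩
      obtain ⟨h5, rfl⟩ := Prod.mk.inj (scall _ _ _ m m')
      exact Prod.ext h5 (e.trans e'.symm)
    · obtain ⟨rfl, h5⟩ := List.cons.inj (e.symm.trans e')
      obtain rfl : φ = φ' := by
        by_contra hne
        exact dret _ _ _ _ _ hne ⟨_, m⟩ ⟨_, m'⟩ w i hw hi ⟨h3, h3'⟩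
      exact Prod.ext (sret _ _ _ _ m m') h5
    · exact absurd (e.symm.trans e') (by simp)
    · exact absurd (e.symm.trans e') (by simp)
    · obtain rfl : φ = φ' := by
        by_contra hne
        exact dret _ _ _ _ _ hne ⟨_, m⟩ ⟨_, m'⟩ w i hw hi ⟨h3, h3'⟩
      exact Prod.ext (sret _ _ _ _ m m') (e2.trans e2'.symm)

theorem reach_congr {s : ℕ} (hst : ∀ c, Reach lab M w s c → Reach lab M w' s c) {i : ℕ}
    (hsi : s ≤ i) (hw : ∀ j, s ≤ j → j < i → w[j]? = w'[j]?)
    (hsat : ∀ j φ, s ≤ j → j < i → (Sat lab w j φ ↔ Sat lab w' j φ)) {c : Q × List Γ}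
    (h : Reach lab M w i c) : Reach lab M w' i c := by
  induction i generalizing c with
  | zero => exact Nat.le_zero.1 hsi ▸ hst c (Nat.le_zero.1 hsi ▸ h)
  | succ i ih =>
    rcases Nat.le_succ_iff.1 hsi with hle | rfl
    · obtain ⟨q, γ, p, φ, h1, h2, h3, h4⟩ := reach_succ_iff.1 h
      exact reach_succ_iff.2 ⟨q, γ, p, φ,
        ih hle (fun j h1 h2 => hw j h1 (by omega)) (fun j φ h1 h2 => hsat j φ h1 (by omega)) h1,
        hw i hle (by omega) ▸ h2, (hsat i φ hle (by omega)).1 h3, h4⟩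
    · exact hst c h

theorem reach_of_neutral {i j : ℕ} (hij : i ≤ j)
    (hn : ∀ m p, i ≤ m → m < j → w[m]? = some p → lab p.1 = .int) {q : Q} {γ : List Γ}
    (h : Reach lab M w j (q, γ)) : ∃ q', Reach lab M w i (q', γ) := by
  induction j generalizing q with
  | zero => exact ⟨q, Nat.le_zero.1 hij ▸ h⟩
  | succ j ih =>
    rcases Nat.le_succ_iff.1 hij with hle | rfl
    · obtain ⟨q', γ', p, φ, h1, h2, -, h4⟩ := reach_succ_iff.1 h
      have hp := hn j p hle (by omega) h2
      simp only [hp, true_and, reduceCtorEq, false_and, or_false] at h4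
      obtain ⟨-, rfl⟩ := h4
      exact ih hle (fun m p h1 h2 => hn m p h1 (by omega)) h1
    · exact ⟨q, h⟩

theorem length_stack {u : List A} {v : List A} (hr : ∀ a ∈ u, lab a ≠ .ret) {c : Q × List Γ}
    (h : Reach lab M (timed (u ++ v)) u.length c) :
    c.2.length = u.countP fun a => lab a = .call := by
  induction u using List.reverseRecOn generalizing v c with
  | nil => simp [(reach_zero_iff.1 h).2]
  | append_singleton u a ih =>
    rw [List.length_append, List.length_singleton] at h
    obtain ⟨q', γ', p, φ, h1, h2, -, h4⟩ := reach_succ_iff.1 h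
    rw [List.append_assoc] at h1
    have h5 := ih (fun b hb => hr b (by simp [hb])) h1
    have ha := hr a (by simp)
    simp only [timed_getElem?, List.append_assoc, List.getElem?_append_right le_rfl, Nat.sub_self,
      List.singleton_append, List.getElem?_cons_zero, Option.map_some, Option.some.injEq] at h2
    subst h2
    simp only [ha, false_and, or_false] at h4
    rcases h4 with ⟨h6, -, h7⟩ | ⟨h6, s, -, h7⟩
    · simp [h7, h5, h6, List.countP_append]
    · simp [h7, h5, h6, List.countP_append]

theorem reach_cut_left {P : List A} (hu : UniqueBrackets lab) (hP : ∀ a, lab a = .int → a ∈ P)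
    {u v v' : List A} (h : v.map lab = v'.map lab) {c : Q × List Γ}
    (hc : Reach lab M (timed (u ++ (P ++ v))) u.length c) :
    Reach lab M (timed (u ++ (P ++ v'))) u.length c := by
  refine reach_congr (s := 0) (fun c hc => ?_) (Nat.zero_le _) (fun j _ hj => ?_)
    (fun j φ _ hj => sat_congr_left hu hP h hj φ) hc
  · rw [reach_zero_iff] at hc ⊢
    exact hc
  · simp only [timed_getElem?, List.getElem?_append_left hj]

theorem accepts_of_reach_cut {P : List A} (hM : M.Deterministic lab) (hu : UniqueBrackets lab)
    (hP : ∀ a, lab a = .int → a ∈ P) {u u' v : List A} (h : u.map lab = u'.map lab)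
    {c : Q × List Γ} (hc : Reach lab M (timed (u ++ (P ++ v))) (u.length + P.length) c)
    (hc' : Reach lab M (timed (u' ++ (P ++ v))) (u.length + P.length) c)
    (hacc : M.Accepts lab (timed (u ++ (P ++ v)))) :
    M.Accepts lab (timed (u' ++ (P ++ v))) := by
  have hlen : u.length = u'.length := by simpa using congrArg List.length h
  obtain ⟨q, γ, hr, hq⟩ := hacc
  refine ⟨q, γ, ?_, hq⟩
  have hL : (timed (u' ++ (P ++ v))).length = (timed (u ++ (P ++ v))).length := by
    simp [length_timed, hlen]
  rw [hL]
  refine reach_congr (s := u.length + P.length)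
    (fun d hd => Reach.unique hM (isTimed_timed _) hd hc ▸ hc') ?_ (fun j hj _ => ?_)
    (fun j φ hj _ => sat_congr_right hu hP h hj φ) hr
  · simp [length_timed]
  · rw [timed_getElem?, timed_getElem?, List.getElem?_append_right (l₁ := u) (by omega),
      List.getElem?_append_right (l₁ := u') (by omega), hlen]

end Runs

section Automaton

/-- The input alphabet: two rotations, a jump marker, a pair of brackets and `k` event symbols. -/
inductive Letter (k : ℕ) : Type
  | rotL
  | rotR
  | jump
  | op
  | cl
  | ev (m : Fin k)

/-- The kinds of the letters. -/
def Letter.kind {k : ℕ} : Letter k → SymbolKind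
  | .op => .call
  | .cl => .ret
  | _ => .int

/-- The states of the nondeterministic automaton. Before the first right bracket it tracks a
number in `left` mode, and may move to `right` mode, via `armed`, when that number is zero;
`post` mode is used after a right bracket. -/
inductive St (n : ℕ) : Type
  | left (i : ZMod n)
  | right (j : ZMod n)
  | post (j : ZMod n)
  | armed

variable {n k : ℕ}

theorem card_letter (k : ℕ) : Nat.card (Letter k) = k + 5 := by
  let e : Letter k ≃ Fin k ⊕ Fin 5 :=
    { toFun := fun a => match a with
        | .ev m => .inl m | .rotL => .inr 0 | .rotR => .inr 1 | .jump => .inr 2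
        | .op => .inr 3 | .cl => .inr 4
      invFun := fun x => match x with
        | .inl m => .ev m | .inr 0 => .rotL | .inr 1 => .rotR | .inr 2 => .jump
        | .inr 3 => .op | .inr 4 => .cl
      left_inv := fun a => by cases a <;> rfl
      right_inv := fun x => by
        rcases x with m | x
        · rfl
        · fin_cases x <;> rfl }
  rw [Nat.card_congr e, Nat.card_sum]
  simp

/-- The states form three copies of `ZMod n` and one more element. -/
def stEquiv (n : ℕ) : St n ≃ ZMod n ⊕ ZMod n ⊕ ZMod n ⊕ Unit where
  toFun
    | .left i => .inl i
    | .right i => .inr (.inl i)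
    | .post i => .inr (.inr (.inl i))
    | .armed => .inr (.inr (.inr ()))
  invFun
    | .inl i => .left i
    | .inr (.inl i) => .right i
    | .inr (.inr (.inl i)) => .post i
    | .inr (.inr (.inr ())) => .armed
  left_inv q := by cases q <;> rfl
  right_inv x := by rcases x with _ | _ | _ | _ <;> rfl

theorem uniqueBrackets_kind : UniqueBrackets (Letter.kind (k := k)) := by
  intro a b h h'
  cases a <;> cases b <;> simp_all [Letter.kind]

/-- The constraint that the event symbol `m` occurred within the last `k` time units. -/
def atom (m : Fin k) : ClockConstraint (Letter k) := .le (.histS (.ev m)) k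

theorem atom_injective : Function.Injective (atom (k := k)) := by
  intro a b h
  simpa [atom] using h

/-- The moves of the automaton on neutral letters. -/
def Step : Letter k → St n → St n → Prop
  | .rotL, .left i, r => r = .left (i + 1)
  | .rotL, .right j, r => r = .right j
  | .rotL, .post j, r => j = 0 ∧ r = .post j
  | .rotR, .left i, r => r = .left i
  | .rotR, .right j, r => r = .right (j + 1)
  | .rotR, .post j, r => r = .post (j + 1)
  | .jump, .left i, r => r = .left i ∨ (i = 0 ∧ r = .armed)
  | .jump, .right j, r => r = .right j
  | .jump, .post j, r => r = .post j
  | .ev _, .left i, r => r = .left i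
  | .ev _, .right j, r => r = .right j
  | .ev _, .post j, r => r = .post j
  | .ev _, .armed, r => r = .right 0
  | _, _, _ => False

/-- The moves of the automaton on strings of neutral letters. -/
def Steps : List (Letter k) → St n → St n → Prop
  | [], q, r => r = q
  | a :: s, q, r => ∃ p, Step a q p ∧ Steps s p r

/-- The nondeterministic automaton. A left bracket pushes the current number together with
the index of some recent event symbol, and the matching right bracket restores that number,
provided that the same event symbol is recent again. -/
def nfa (n k : ℕ) : ECIDPDA (Letter k) (St n) (ZMod n × Fin k) where
  init := {.left 0}
  final := {q | ∃ j, q = .post j}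
  δint a q φ := {r | φ = .tt ∧ Step a q r}
  δcall _ q φ := {c | ∃ j m, q = .right j ∧ φ = atom m ∧ c = (.left j, (j, m))}
  δret _ s q φ := {r | ∃ j m, s = some (j, m) ∧ q ≠ .armed ∧ φ = atom m ∧ r = .post j}

theorem nfa_atomicSet_subset : (nfa n k).atomicSet ⊆ Set.range atom := by
  intro φ hφ
  simp only [ECIDPDA.atomicSet, Set.mem_iUnion] at hφ
  obtain ⟨ψ, hψ, hφ⟩ := hφ
  rcases hψ with ⟨a, q, r, rfl, -⟩ | ⟨a, q, r, j, m, -, rfl, -⟩ | ⟨a, s, q, r, j, m, -, -, rfl, -⟩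
  · exact hφ.elim
  · exact ⟨m, hφ.symm⟩
  · exact ⟨m, hφ.symm⟩

theorem steps_append (s t : List (Letter k)) (q r : St n) :
    Steps (s ++ t) q r ↔ ∃ p, Steps s q p ∧ Steps t p r := by
  induction s generalizing q with
  | nil => simp [Steps]
  | cons a s ih =>
    simp only [List.cons_append, Steps, ih]
    constructor
    · rintro ⟨p, h1, p', h2, h3⟩
      exact ⟨p', ⟨p, h1, h2⟩, h3⟩
    · rintro ⟨p', ⟨p, h1, h2⟩, h3⟩
      exact ⟨p, h1, p', h2, h3⟩

theorem steps_singleton (a : Letter k) (q r : St n) : Steps [a] q r ↔ Step a q r := by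
  simp [Steps]

theorem steps_ev {s : List (Letter k)} (hs : ∀ a ∈ s, ∃ m, a = .ev m) {q : St n}
    (hq : q ≠ .armed) (r : St n) : Steps s q r ↔ r = q := by
  induction s with
  | nil => rfl
  | cons a s ih =>
    obtain ⟨m, rfl⟩ := hs a (by simp)
    cases q <;> simp_all [Steps, Step]

theorem steps_replicate_rotR_post (t : ℕ) (j : ZMod n) (r : St n) :
    Steps (List.replicate t (.rotR : Letter k)) (.post j) r ↔ r = .post (j + t) := by
  induction t generalizing j with
  | zero => simp [Steps]
  | succ t ih => simp [List.replicate_succ, Steps, Step, ih, add_assoc, add_comm (1 : ZMod n)]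

/-- A string which sends `post z` to itself and blocks all other `post` states. -/
def query (k : ℕ) (z : ZMod n) : List (Letter k) :=
  List.replicate (-z).val .rotR ++ .rotL :: List.replicate (n - (-z).val) .rotR

theorem steps_query [NeZero n] (z j : ZMod n) (r : St n) :
    Steps (query k z) (.post j) r ↔ j = z ∧ r = .post j := by
  have h : ((n - (-z).val : ℕ) : ZMod n) = z := by
    rw [Nat.cast_sub (ZMod.val_lt _).le]
    simp
  simp only [query, steps_append, steps_replicate_rotR_post, exists_eq_left, Steps, Step,
    ZMod.natCast_val, ZMod.cast_id', id_eq]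
  constructor
  · rintro ⟨p, ⟨h1, rfl⟩, h2⟩
    rw [steps_replicate_rotR_post, h] at h2
    exact ⟨by linear_combination h1, by simpa using h2⟩
  · rintro ⟨rfl, rfl⟩
    exact ⟨_, ⟨by simp, rfl⟩, by rw [steps_replicate_rotR_post, h]; simp⟩

/-- Reachability in the automaton `nfa n k` on a timed string. -/
abbrev NReach (l : List (Letter k)) : ℕ → St n × List (ZMod n × Fin k) → Prop :=
  Reach Letter.kind (nfa n k) (timed l)

theorem nreach_neutral {l u s v : List (Letter k)} (hl : l = u ++ (s ++ v))
    (hs : ∀ a ∈ s, a.kind = .int) (c : St n × List (ZMod n × Fin k)) :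
    NReach l (u.length + s.length) c ↔
      ∃ q, NReach l u.length (q, c.2) ∧ Steps s q c.1 := by
  induction s generalizing u with
  | nil =>
    obtain ⟨q, γ⟩ := c
    simp [Steps]
  | cons a s ih =>
    have h1 := ih (u := u ++ [a]) (by simp [hl]) fun b hb => hs b (by simp [hb])
    have ha := hs a (by simp)
    have hget : (timed l)[u.length]? = some (a, (u.length : ℝ)) := by
      simp [timed_getElem?, hl]
    rw [List.length_append, List.length_singleton] at h1
    rw [List.length_cons, add_comm s.length, ← add_assoc, h1]
    constructor
    · rintro ⟨p, h2, h3⟩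
      obtain ⟨q, γ, p', φ, h4, h5, -, h6⟩ := reach_succ_iff.1 h2
      obtain rfl := Option.some.inj (hget.symm.trans h5)
      simp only [ha, true_and, reduceCtorEq, false_and, or_false] at h6
      obtain ⟨h6, rfl⟩ := h6
      exact ⟨q, h4, p, h6.2, h3⟩
    · rintro ⟨q, h2, p, h3, h4⟩
      exact ⟨p, reach_succ_iff.2 ⟨q, c.2, _, .tt, h2, hget, trivial, .inl ⟨ha, ⟨rfl, h3⟩, rfl⟩⟩, h4⟩

theorem kind_of_mem_query {z : ZMod n} {a : Letter k} (ha : a ∈ query k z) : a.kind = .int := by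
  simp only [query, List.mem_append, List.mem_cons, List.mem_replicate] at ha
  rcases ha with ⟨-, rfl⟩ | rfl | ⟨-, rfl⟩ <;> rfl

theorem length_query [NeZero n] (z : ZMod n) : (query k z).length = n + 1 := by
  have := (ZMod.val_lt (-z)).le
  simp [query]
  omega

theorem map_kind_eq_of_neutral {s t : List (Letter k)} (hs : ∀ a ∈ s, a.kind = .int)
    (ht : ∀ a ∈ t, a.kind = .int) (h : s.length = t.length) :
    s.map Letter.kind = t.map Letter.kind := by
  rw [List.map_eq_replicate_iff.2 hs, List.map_eq_replicate_iff.2 ht, h]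

/-- The data of one bracket level: two relations, of which the union is used, and the set of
event symbols preceding the left bracket. -/
structure Level (n k : ℕ) where
  fst : Finset (ZMod n × ZMod n)
  snd : Finset (ZMod n × ZMod n)
  mask : Finset (Fin k)

/-- The numbers listed in `Y` form a path from `i` through the relations of the levels,
labelled by event symbols belonging to the masks. -/
def Path : ZMod n → List (Level n k) → List (ZMod n × Fin k) → Prop
  | _, [], [] => True
  | i, b :: L, y :: Y => ((i, y.1) ∈ b.fst ∨ (i, y.1) ∈ b.snd) ∧ y.2 ∈ b.mask ∧ Path y.1 L Y
  | _, _, _ => False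

theorem Path.length_eq {i : ZMod n} {L : List (Level n k)} {Y : List (ZMod n × Fin k)}
    (h : Path i L Y) : Y.length = L.length := by
  induction L generalizing i Y with
  | nil => cases Y <;> simp_all [Path]
  | cons b L ih =>
    cases Y with
    | nil => exact h.elim
    | cons y Y => simpa using ih h.2.2

variable [NeZero k]

/-- A letter group encoding one bit; if the bit is set, the automaton may jump from `left 0`. -/
def slot (k : ℕ) [NeZero k] (b : Bool) : List (Letter k) :=
  (bif b then [.jump, .ev 0] else [.ev 0, .jump]) ++ [.rotR]

theorem steps_slot_left (b : Bool) (i : ZMod n) (r : St n) :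
    Steps (slot k b) (.left i) r ↔ r = .left i ∨ b = true ∧ i = 0 ∧ r = .right 1 := by
  cases b
  · simp [slot, Steps, Step]
  · simp only [slot, cond_true, List.cons_append, List.nil_append, Steps, Step, true_and]
    constructor
    · rintro ⟨p, rfl | ⟨h, rfl⟩, h2⟩
      · left; simpa [Step] using h2
      · right; simpa [Step, h] using h2
    · rintro (rfl | ⟨h, rfl⟩)
      · exact ⟨_, .inl rfl, by simp⟩
      · exact ⟨_, .inr ⟨h, rfl⟩, by simp⟩

theorem steps_slot_right (b : Bool) (j : ZMod n) (r : St n) :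
    Steps (slot k b) (.right j) r ↔ r = .right (j + 1) := by
  cases b <;> simp [slot, Steps, Step]

/-- The first `t` entries of row `-x` of the relation `R`. -/
def row (k : ℕ) [NeZero k] (R : Finset (ZMod n × ZMod n)) (x : ZMod n) (t : ℕ) : List (Letter k) :=
  (List.range t).flatMap fun y : ℕ => slot k (decide ((-x, -(y : ZMod n)) ∈ R))

theorem row_succ (R : Finset (ZMod n × ZMod n)) (x : ZMod n) (t : ℕ) :
    row k R x (t + 1) = row k R x t ++ slot k (decide ((-x, -(t : ZMod n)) ∈ R)) := by
  simp [row, List.range_succ]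

theorem steps_row_right (R : Finset (ZMod n × ZMod n)) (x : ZMod n) (t : ℕ) (j : ZMod n)
    (r : St n) : Steps (row k R x t) (.right j) r ↔ r = .right (j + t) := by
  induction t generalizing r with
  | zero => simp [row, Steps]
  | succ t ih => simp [row_succ, steps_append, ih, steps_slot_right, add_assoc]

theorem steps_row_left (R : Finset (ZMod n × ZMod n)) (x : ZMod n) (t : ℕ) (i : ZMod n)
    (r : St n) : Steps (row k R x t) (.left i) r ↔ r = .left i ∨
      ∃ y < t, i = 0 ∧ (-x, -(y : ZMod n)) ∈ R ∧ r = .right (t - y) := by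
  induction t generalizing r with
  | zero => simp [row, Steps]
  | succ t ih =>
    simp only [row_succ, steps_append, ih]
    constructor
    · rintro ⟨p, rfl | ⟨y, hy, hi, hR, rfl⟩, h2⟩
      · rw [steps_slot_left] at h2
        rcases h2 with rfl | ⟨hb, hi, rfl⟩
        · exact .inl rfl
        · exact .inr ⟨t, by omega, hi, of_decide_eq_true hb, by simp⟩
      · rw [steps_slot_right] at h2
        exact .inr ⟨y, by omega, hi, hR, by rw [h2]; push_cast; congr 1; ring⟩
    · rintro (rfl | ⟨y, hy, hi, hR, rfl⟩)
      · exact ⟨_, .inl rfl, (steps_slot_left _ _ _).2 (.inl rfl)⟩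
      · rcases Nat.lt_succ_iff_lt_or_eq.1 hy with hy | rfl
        · refine ⟨_, .inr ⟨y, hy, hi, hR, rfl⟩, (steps_slot_right _ _ _).2 ?_⟩
          push_cast; congr 1; ring
        · exact ⟨_, .inl rfl, (steps_slot_left _ _ _).2 (.inr ⟨decide_eq_true hR, hi, by simp⟩)⟩

/-- The first `t` rows of the encoding of the relation `R`. -/
def rows (k : ℕ) [NeZero k] (R : Finset (ZMod n × ZMod n)) (t : ℕ) : List (Letter k) :=
  (List.range t).flatMap fun x : ℕ => row k R x n ++ [.rotL]

theorem rows_succ (R : Finset (ZMod n × ZMod n)) (t : ℕ) :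
    rows k R (t + 1) = rows k R t ++ (row k R t n ++ [.rotL]) := by
  simp [rows, List.range_succ]

theorem steps_rows_right (R : Finset (ZMod n × ZMod n)) (t : ℕ) (j : ZMod n) (r : St n) :
    Steps (rows k R t) (.right j) r ↔ r = .right j := by
  induction t generalizing r with
  | zero => simp [rows, Steps]
  | succ t ih => simp [rows_succ, steps_append, ih, steps_row_right, steps_singleton, Step]

theorem steps_rows_left (R : Finset (ZMod n × ZMod n)) (t : ℕ) (i : ZMod n) (r : St n) :
    Steps (rows k R t) (.left i) r ↔ r = .left (i + t) ∨
      ∃ x < t, i + x = 0 ∧ ∃ y < n, (-(x : ZMod n), -(y : ZMod n)) ∈ R ∧ r = .right (-y) := by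
  induction t generalizing r with
  | zero => simp [rows, Steps]
  | succ t ih =>
    simp only [rows_succ, steps_append, ih, steps_singleton]
    constructor
    · rintro ⟨p, rfl | ⟨x, hx, hi, y, hy, hR, rfl⟩, p', h2, h3⟩
      · rw [steps_row_left] at h2
        rcases h2 with rfl | ⟨y, hy, hi, hR, rfl⟩
        · exact .inl (by simpa [Step, add_assoc] using h3)
        · exact .inr ⟨t, by omega, hi, y, hy, hR, by simpa [Step] using h3⟩
      · rw [steps_row_right] at h2
        subst h2
        exact .inr ⟨x, by omega, hi, y, hy, hR, by simpa [Step] using h3⟩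
    · rintro (rfl | ⟨x, hx, hi, y, hy, hR, rfl⟩)
      · exact ⟨_, .inl rfl, _, (steps_row_left ..).2 (.inl rfl), by simp [Step, add_assoc]⟩
      · rcases Nat.lt_succ_iff_lt_or_eq.1 hx with hx | rfl
        · exact ⟨_, .inr ⟨x, hx, hi, y, hy, hR, rfl⟩, _, (steps_row_right ..).2 rfl,
            by simp [Step]⟩
        · exact ⟨_, .inl rfl, _, (steps_row_left ..).2 (.inr ⟨y, hy, hi, hR, rfl⟩),
            by simp [Step]⟩

theorem steps_rows_self_left [NeZero n] (R : Finset (ZMod n × ZMod n)) (i : ZMod n) (r : St n) :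
    Steps (rows k R n) (.left i) r ↔ r = .left i ∨ ∃ j, (i, j) ∈ R ∧ r = .right j := by
  rw [steps_rows_left, CharP.cast_eq_zero, add_zero]
  refine or_congr_right ⟨?_, ?_⟩
  · rintro ⟨x, -, hi, y, -, hR, rfl⟩
    exact ⟨_, by rwa [eq_neg_of_add_eq_zero_left hi], rfl⟩
  · rintro ⟨j, hR, rfl⟩
    exact ⟨(-i).val, ZMod.val_lt _, by simp, (-j).val, ZMod.val_lt _, by simpa using hR, by simp⟩


/-- A string of `k` event symbols in which exactly those of `K` occur. -/
def window (K : Finset (Fin k)) : List (Letter k) :=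
  List.ofFn fun m => .ev (if m ∈ K then m else if h : K.Nonempty then K.min' h else 0)

theorem length_window (K : Finset (Fin k)) : (window K).length = k := by
  simp [window]

theorem exists_eq_ev_of_mem_window {K : Finset (Fin k)} {a : Letter k} (ha : a ∈ window K) :
    ∃ m, a = .ev m := by
  rw [window, List.mem_ofFn] at ha
  obtain ⟨m, rfl⟩ := ha
  exact ⟨_, rfl⟩

theorem ev_mem_window {K : Finset (Fin k)} (hK : K.Nonempty) (m : Fin k) :
    .ev m ∈ window K ↔ m ∈ K := by
  simp only [window, List.mem_ofFn, Letter.ev.injEq, dif_pos hK]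
  constructor
  · rintro ⟨m', rfl⟩
    split_ifs with h
    · exact h
    · exact K.min'_mem hK
  · exact fun h => ⟨m, if_pos h⟩

/-- A string containing all neutral letters, which does not change the state. -/
def pad (n k : ℕ) [NeZero k] : List (Letter k) :=
  rows k (∅ : Finset (ZMod n × ZMod n)) n ++ window Finset.univ

theorem steps_pad_left [NeZero n] (i : ZMod n) (r : St n) :
    Steps (pad n k) (.left i) r ↔ r = .left i := by
  simp [pad, steps_append, steps_rows_self_left,
    steps_ev (fun a ha => exists_eq_ev_of_mem_window ha)]

theorem steps_pad_right (j : ZMod n) (r : St n) :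
    Steps (pad n k) (.right j) r ↔ r = .right j := by
  simp [pad, steps_append, steps_rows_right,
    steps_ev (fun a ha => exists_eq_ev_of_mem_window ha)]

theorem mem_pad [NeZero n] (a : Letter k) (ha : a.kind = .int) : a ∈ pad n k := by
  have h0 : 0 ∈ List.range n := List.mem_range.2 (NeZero.pos n)
  cases a with
  | op => cases ha
  | cl => cases ha
  | ev m => exact List.mem_append_right _ ((ev_mem_window ⟨m, Finset.mem_univ m⟩ m).2 (by simp))
  | rotL => exact List.mem_append_left _ (List.mem_flatMap.2 ⟨0, h0, by simp⟩)
  | rotR =>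
    refine List.mem_append_left _ (List.mem_flatMap.2 ⟨0, h0, List.mem_append_left _ ?_⟩)
    exact List.mem_flatMap.2 ⟨0, h0, by simp [slot]⟩
  | jump =>
    refine List.mem_append_left _ (List.mem_flatMap.2 ⟨0, h0, List.mem_append_left _ ?_⟩)
    exact List.mem_flatMap.2 ⟨0, h0, by simp [slot]⟩

theorem sat_atom_iff (lab : Letter k → SymbolKind) {u v : List (Letter k)} {a : Letter k}
    {K : Finset (Fin k)} (hK : K.Nonempty) (m : Fin k) :
    Sat lab (timed (u ++ (window K ++ a :: v))) (u.length + k) (atom m) ↔ m ∈ K := by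
  have hlen := length_window K
  simp only [Sat, atom, clockVal_histS_timed]
  constructor
  · rintro ⟨_, ⟨-, j, ⟨h1, h2, -⟩, rfl⟩, h3⟩
    have h4 : u.length ≤ j := by
      have : (u.length : ℝ) ≤ j := by push_cast at h3; linarith
      exact_mod_cast this
    rw [List.getElem?_append_right h4, List.getElem?_append_left (by omega)] at h2
    exact (ev_mem_window hK m).1 (List.mem_of_getElem? h2)
  · intro hm
    obtain ⟨j, hj, e⟩ := List.getElem_of_mem ((ev_mem_window hK m).2 hm)
    obtain ⟨j', h1, h2⟩ := exists_lastOcc (l := u ++ (window K ++ a :: v)) (a := .ev m)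
      (i := u.length + k) (j := u.length + j) (by omega)
      (by simp [List.getElem?_append, hj, e])
    refine ⟨_, ⟨by simp [hlen], j', h2, rfl⟩, ?_⟩
    have : (u.length : ℝ) ≤ j' := by exact_mod_cast (by omega : u.length ≤ j')
    push_cast
    linarith

theorem nreach_op {l u v : List (Letter k)} {K : Finset (Fin k)} (hK : K.Nonempty)
    (hl : l = u ++ (window K ++ .op :: v)) (c : St n × List (ZMod n × Fin k)) :
    NReach l (u.length + k + 1) c ↔ ∃ j m γ, NReach l (u.length + k) (.right j, γ) ∧ m ∈ K ∧
      c = (.left j, (j, m) :: γ) := by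
  have hget : (timed l)[u.length + k]? = some (.op, ((u.length + k : ℕ) : ℝ)) := by
    simp [timed_getElem?, hl, length_window]
  obtain ⟨q', γ'⟩ := c
  constructor
  · intro h
    obtain ⟨q, γ, p, φ, h1, h2, h3, h4⟩ := reach_succ_iff.1 h
    obtain rfl := Option.some.inj (hget.symm.trans h2)
    simp only [Letter.kind, true_and, reduceCtorEq, false_and, or_false, false_or] at h4
    obtain ⟨s, ⟨j, m, rfl, rfl, h5⟩, rfl⟩ := h4
    obtain ⟨rfl, rfl⟩ := Prod.mk.inj h5
    rw [hl, sat_atom_iff _ hK] at h3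
    exact ⟨j, m, γ, h1, h3, rfl⟩
  · rintro ⟨j, m, γ, h1, h2, h3⟩
    obtain ⟨rfl, rfl⟩ := Prod.mk.inj h3
    refine reach_succ_iff.2 ⟨_, γ, _, atom m, h1, hget, ?_,
      .inr (.inl ⟨rfl, (j, m), ⟨j, m, rfl, rfl, rfl⟩, rfl⟩)⟩
    rwa [hl, sat_atom_iff _ hK]

theorem nreach_cl {l u v : List (Letter k)} {K : Finset (Fin k)} (hK : K.Nonempty)
    (hl : l = u ++ (window K ++ .cl :: v)) (c : St n × List (ZMod n × Fin k)) :
    NReach l (u.length + k + 1) c ↔ ∃ q j m, NReach l (u.length + k) (q, (j, m) :: c.2) ∧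
      q ≠ .armed ∧ m ∈ K ∧ c.1 = .post j := by
  have hget : (timed l)[u.length + k]? = some (.cl, ((u.length + k : ℕ) : ℝ)) := by
    simp [timed_getElem?, hl, length_window]
  obtain ⟨q', γ'⟩ := c
  constructor
  · intro h
    obtain ⟨q, γ, p, φ, h1, h2, h3, h4⟩ := reach_succ_iff.1 h
    obtain rfl := Option.some.inj (hget.symm.trans h2)
    simp only [Letter.kind, true_and, reduceCtorEq, false_and, false_or] at h4
    rcases h4 with ⟨s, ⟨j, m, hs, h5, rfl, h6⟩, rfl⟩ | ⟨⟨j, m, hs, -⟩, -⟩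
    · obtain rfl := Option.some.inj hs
      rw [hl, sat_atom_iff _ hK] at h3
      exact ⟨q, j, m, h1, h5, h3, h6⟩
    · cases hs
  · rintro ⟨q, j, m, h1, h2, h3, h4⟩
    refine reach_succ_iff.2 ⟨q, _, _, atom m, h1, hget, ?_,
      .inr (.inr (.inl ⟨rfl, (j, m), ⟨j, m, rfl, h2, rfl, h4⟩, rfl⟩))⟩
    rwa [hl, sat_atom_iff _ hK]

theorem kind_of_mem_window {K : Finset (Fin k)} {a : Letter k} (ha : a ∈ window K) :
    a.kind = .int := by
  obtain ⟨m, rfl⟩ := exists_eq_ev_of_mem_window ha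
  rfl

theorem kind_of_mem_rows {R : Finset (ZMod n × ZMod n)} {t : ℕ} {a : Letter k}
    (ha : a ∈ rows k R t) : a.kind = .int := by
  simp only [rows, row, slot, List.mem_flatMap, List.mem_append, List.mem_singleton] at ha
  obtain ⟨x, -, ⟨y, -, ha | rfl⟩ | rfl⟩ := ha
  · cases h : decide ((-(x : ZMod n), -(y : ZMod n)) ∈ R) <;>
      rw [h] at ha <;> simp at ha <;> rcases ha with rfl | rfl <;> rfl
  · rfl
  · rfl

theorem kind_of_mem_pad {a : Letter k} (ha : a ∈ pad n k) : a.kind = .int := by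
  rcases List.mem_append.1 ha with ha | ha
  · exact kind_of_mem_rows ha
  · exact kind_of_mem_window ha

theorem length_row (R : Finset (ZMod n × ZMod n)) (x : ZMod n) (t : ℕ) :
    (row k R x t).length = 3 * t := by
  induction t with
  | zero => simp [row]
  | succ t ih =>
    rw [row_succ, List.length_append, ih, slot]
    cases decide ((-x, -(t : ZMod n)) ∈ R) <;> simp <;> ring

theorem length_rows (R : Finset (ZMod n × ZMod n)) (t : ℕ) :
    (rows k R t).length = (3 * n + 1) * t := by
  induction t with
  | zero => simp [rows]
  | succ t ih => simp [rows_succ, ih, length_row]; ring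

/-- The neutral beginning of a level. -/
def core (b : Level n k) : List (Letter k) :=
  pad n k ++ (pad n k ++ (rows k b.fst n ++ (pad n k ++ (pad n k ++ rows k b.snd n))))

/-- The string opening a bracket level. -/
def block (b : Level n k) : List (Letter k) := core b ++ (window b.mask ++ [.op])

/-- The string closing a bracket level. -/
def unwind (y : ZMod n × Fin k) : List (Letter k) := window {y.2} ++ .cl :: query k y.1

theorem kind_of_mem_core {b : Level n k} {a : Letter k} (ha : a ∈ core b) : a.kind = .int := by
  simp only [core, List.mem_append] at ha
  rcases ha with ha | ha | ha | ha | ha | ha <;>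
    first | exact kind_of_mem_pad ha | exact kind_of_mem_rows ha

theorem steps_core [NeZero n] (b : Level n k) (i : ZMod n) (r : St n) :
    Steps (core b) (.left i) r ↔
      r = .left i ∨ ∃ j, ((i, j) ∈ b.fst ∨ (i, j) ∈ b.snd) ∧ r = .right j := by
  simp only [core, steps_append, steps_pad_left, exists_eq_left, steps_rows_self_left]
  constructor
  · rintro ⟨p, rfl | ⟨j, hj, rfl⟩, h⟩
    · simp only [steps_pad_left, exists_eq_left, steps_rows_self_left] at h
      rcases h with rfl | ⟨j, hj, rfl⟩
      · exact .inl rfl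
      · exact .inr ⟨j, .inr hj, rfl⟩
    · simp only [steps_pad_right, exists_eq_left, steps_rows_right] at h
      exact .inr ⟨j, .inl hj, h⟩
  · rintro (rfl | ⟨j, hj | hj, rfl⟩)
    · exact ⟨_, .inl rfl, by simp [steps_pad_left, steps_rows_self_left]⟩
    · exact ⟨_, .inr ⟨j, hj, rfl⟩, by simp [steps_pad_right, steps_rows_right]⟩
    · exact ⟨_, .inl rfl, by simp [steps_pad_left, steps_rows_self_left, hj]⟩

theorem nreach_block [NeZero n] {l u v : List (Letter k)} {b : Level n k} (hK : b.mask.Nonempty)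
    (hl : l = u ++ (block b ++ v))
    (hu : ∀ c : St n × List (ZMod n × Fin k), NReach l u.length c → ∃ i, c.1 = .left i)
    (c : St n × List (ZMod n × Fin k)) :
    NReach l (u ++ block b).length c ↔ ∃ i γ j m, NReach l u.length (.left i, γ) ∧
      ((i, j) ∈ b.fst ∨ (i, j) ∈ b.snd) ∧ m ∈ b.mask ∧ c = (.left j, (j, m) :: γ) := by
  have hl' : l = (u ++ core b) ++ (window b.mask ++ .op :: v) := by simp [hl, block]
  have e1 : (u ++ block b).length = (u ++ core b).length + k + 1 := by
    simp [block, length_window]; omega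
  have e2 : (u ++ core b).length + k = u.length + (core b ++ window b.mask).length := by
    simp [length_window]; omega
  rw [e1, nreach_op hK hl', e2]
  have h3 := nreach_neutral (n := n) (l := l) (u := u) (s := core b ++ window b.mask)
    (v := .op :: v) (by simp [hl, block]) (by
      intro a ha
      rcases List.mem_append.1 ha with ha | ha
      · exact kind_of_mem_core ha
      · exact kind_of_mem_window ha)
  constructor
  · rintro ⟨j, m, γ, h1, hm, rfl⟩
    rw [h3] at h1
    obtain ⟨q, h1, h2⟩ := h1
    obtain ⟨i, rfl⟩ := hu _ h1
    obtain ⟨p, h4, h5⟩ := (steps_append ..).1 h2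
    rw [steps_core] at h4
    have hp : p ≠ .armed := by
      rcases h4 with rfl | ⟨_, _, rfl⟩ <;> simp
    rw [steps_ev (fun a ha => exists_eq_ev_of_mem_window ha) hp] at h5
    subst h5
    rcases h4 with h4 | ⟨j', h4, h5⟩
    · cases h4
    · cases h5
      exact ⟨i, γ, j, m, h1, h4, hm, rfl⟩
  · rintro ⟨i, γ, j, m, h1, h2, hm, rfl⟩
    refine ⟨j, m, γ, (h3 _).2 ⟨.left i, h1, (steps_append ..).2
      ⟨.right j, (steps_core ..).2 (.inr ⟨j, h2, rfl⟩), ?_⟩⟩, hm, rfl⟩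
    rw [steps_ev (fun a ha => exists_eq_ev_of_mem_window ha) (by simp)]

theorem nreach_flatMap_block [NeZero n] {l u v : List (Letter k)} {L : List (Level n k)}
    (hK : ∀ b ∈ L, b.mask.Nonempty) (hl : l = u ++ (L.flatMap block ++ v))
    (hu : ∀ c : St n × List (ZMod n × Fin k), NReach l u.length c → ∃ i, c.1 = .left i) :
    (∀ c : St n × List (ZMod n × Fin k), NReach l (u ++ L.flatMap block).length c →
      ∃ i, c.1 = .left i) ∧
    ∀ γ' : List (ZMod n × Fin k), (∃ q, NReach l (u ++ L.flatMap block).length (q, γ')) ↔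
      ∃ i γ Y, NReach l u.length (.left i, γ) ∧ Path i L Y ∧ γ' = Y.reverse ++ γ := by
  induction L generalizing u with
  | nil =>
    simp only [List.flatMap_nil, List.append_nil]
    refine ⟨hu, fun γ' => ⟨?_, ?_⟩⟩
    · rintro ⟨q, hq⟩
      obtain ⟨i, rfl⟩ := hu _ hq
      exact ⟨i, γ', [], hq, trivial, rfl⟩
    · rintro ⟨i, γ, Y, h1, h2, rfl⟩
      obtain rfl := List.length_eq_zero_iff.1 h2.length_eq
      exact ⟨_, h1⟩
  | cons b L ih =>
    have hb := nreach_block (hK b (by simp)) (u := u) (v := L.flatMap block ++ v)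
      (by simp [hl]) hu
    have := ih (u := u ++ block b) (fun b' hb' => hK b' (by simp [hb'])) (by simp [hl])
      (fun c hc => by
        obtain ⟨i, γ, j, m, -, -, -, rfl⟩ := (hb c).1 hc
        exact ⟨j, rfl⟩)
    rw [List.flatMap_cons, ← List.append_assoc]
    refine ⟨this.1, fun γ' => (this.2 γ').trans ⟨?_, ?_⟩⟩
    · rintro ⟨i, γ, Y, h1, h2, rfl⟩
      obtain ⟨i', γ', j, m, h3, h4, h5, h6⟩ := (hb _).1 h1
      simp only [Prod.mk.injEq, St.left.injEq] at h6
      obtain ⟨rfl, rfl⟩ := h6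
      exact ⟨i', γ', (i, m) :: Y, h3, ⟨h4, h5, h2⟩, by simp⟩
    · rintro ⟨i, γ, Y, h1, h2, rfl⟩
      cases Y with
      | nil => exact h2.elim
      | cons y Y =>
        exact ⟨y.1, y :: γ, Y, (hb _).2 ⟨i, γ, y.1, y.2, h1, h2.1, h2.2.1, rfl⟩, h2.2.2, by simp⟩

theorem nreach_unwind [NeZero n] {l u v : List (Letter k)} {y : ZMod n × Fin k}
    (hl : l = u ++ (unwind y ++ v))
    (hu : ∀ c : St n × List (ZMod n × Fin k), NReach l u.length c → c.1 ≠ .armed)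
    (c : St n × List (ZMod n × Fin k)) :
    NReach l (u ++ unwind y).length c ↔
      (∃ q, NReach l u.length (q, y :: c.2)) ∧ c.1 = .post y.1 := by
  have hlen := length_window {y.2}
  have hl' : l = u ++ (window {y.2} ++ .cl :: (query k y.1 ++ v)) := by simp [hl, unwind]
  have hw := nreach_neutral (n := n) hl' fun a ha => kind_of_mem_window ha
  have hq := nreach_neutral (n := n) (l := l) (u := u ++ (window {y.2} ++ [Letter.cl]))
    (s := query k y.1) (v := v) (by simp [hl']) fun a ha => kind_of_mem_query ha
  have e1 : (u ++ unwind y).length =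
      (u ++ (window {y.2} ++ [Letter.cl])).length + (query k y.1).length := by
    simp [unwind]; omega
  have e2 : (u ++ (window {y.2} ++ [Letter.cl])).length = u.length + k + 1 := by
    simp [hlen]; omega
  rw [hlen] at hw
  rw [e1, hq, e2]
  constructor
  · rintro ⟨q, h1, h2⟩
    obtain ⟨q', j, m, h3, h4, h5, h6⟩ := (nreach_cl (Finset.singleton_nonempty _) hl' _).1 h1
    obtain ⟨q'', h7, -⟩ := (hw _).1 h3
    simp only at h6
    subst h6
    obtain ⟨rfl, h8⟩ := (steps_query ..).1 h2
    obtain rfl := Finset.mem_singleton.1 h5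
    exact ⟨⟨q'', h7⟩, h8⟩
  · rintro ⟨⟨q, h1⟩, h2⟩
    have ha := hu _ h1
    refine ⟨.post y.1, (nreach_cl (Finset.singleton_nonempty _) hl' _).2
      ⟨q, y.1, y.2, (hw _).2 ⟨q, h1, ?_⟩, ha, Finset.mem_singleton_self _, rfl⟩, ?_⟩
    · rw [steps_ev (fun a ha => exists_eq_ev_of_mem_window ha) ha]
    · rw [steps_query]
      exact ⟨rfl, h2⟩

theorem nreach_flatMap_unwind [NeZero n] {l u v : List (Letter k)} {V : List (ZMod n × Fin k)}
    (hl : l = u ++ (V.flatMap unwind ++ v))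
    (hu : ∀ c : St n × List (ZMod n × Fin k), NReach l u.length c → c.1 ≠ .armed) (hV : V ≠ [])
    (γ : List (ZMod n × Fin k)) :
    (∃ q, NReach l (u ++ V.flatMap unwind).length (q, γ) ∧ ∃ j, q = .post j) ↔
      ∃ q, NReach l u.length (q, V ++ γ) := by
  induction V generalizing u with
  | nil => exact absurd rfl hV
  | cons y V ih =>
    have hy := nreach_unwind (u := u) (y := y) (v := V.flatMap unwind ++ v) (by simp [hl]) hu
    rw [List.flatMap_cons, ← List.append_assoc]
    rcases eq_or_ne V [] with rfl | hV'
    · simp only [List.flatMap_nil, List.append_nil, hy]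
      exact ⟨fun ⟨_, ⟨h, _⟩, _⟩ => h, fun h => ⟨_, ⟨h, rfl⟩, _, rfl⟩⟩
    · rw [ih (u := u ++ unwind y) (by simp [hl]) (fun c hc => by simp [((hy c).1 hc).2]) hV']
      simp only [hy]
      exact ⟨fun ⟨_, h, _⟩ => h, fun h => ⟨_, h, rfl⟩⟩

/-- The string opening the levels `L` and then closing them with the expected contents `Y`. -/
def word (L : List (Level n k)) (Y : List (ZMod n × Fin k)) : List (Letter k) :=
  L.flatMap block ++ (pad n k ++ (pad n k ++ Y.reverse.flatMap unwind))

theorem nfa_accepts_word [NeZero n] {L : List (Level n k)} {Y : List (ZMod n × Fin k)}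
    (hK : ∀ b ∈ L, b.mask.Nonempty) (hY : Y.length = L.length) (hL : L ≠ []) :
    (nfa n k).Accepts Letter.kind (timed (word L Y)) ↔ Path 0 L Y := by
  set l := word L Y with hl
  obtain ⟨h1, h2⟩ := nreach_flatMap_block (n := n) (l := l) (u := []) hK rfl (fun c hc =>
    ⟨0, (reach_zero_iff.1 hc).1⟩)
  rw [List.nil_append] at h1 h2
  have hp := nreach_neutral (n := n) (l := l) (u := L.flatMap block)
    (s := pad n k ++ pad n k) (v := Y.reverse.flatMap unwind) (by simp [hl, word])
    (fun a ha => by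
      rcases List.mem_append.1 ha with ha | ha <;> exact kind_of_mem_pad ha)
  rw [← List.length_append] at hp
  have hsteps : ∀ (i : ZMod n) (r : St n), Steps (pad n k ++ pad n k) (.left i) r ↔ r = .left i := by
    intro i r
    simp [steps_append, steps_pad_left]
  have hY' : Y.reverse ≠ [] := by
    rw [ne_eq, List.reverse_eq_nil_iff]
    rintro rfl
    exact hL (List.length_eq_zero_iff.1 hY.symm)
  have hun := nreach_flatMap_unwind (n := n) (l := l) (u := L.flatMap block ++ (pad n k ++ pad n k))
    (v := []) (V := Y.reverse) (by simp [hl, word]) (fun c hc => by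
      obtain ⟨q, h3, h4⟩ := (hp c).1 hc
      obtain ⟨i, rfl⟩ := h1 _ h3
      rw [(hsteps _ _).1 h4]
      simp) hY'
  have hend : (timed l).length =
      (L.flatMap block ++ (pad n k ++ pad n k) ++ Y.reverse.flatMap unwind).length := by
    simp [length_timed, hl, word]
  have hmid : ∀ γ : List (ZMod n × Fin k),
      (∃ q, NReach l (L.flatMap block ++ (pad n k ++ pad n k)).length (q, γ)) ↔
      ∃ q, NReach l (L.flatMap block).length (q, γ) := by
    intro γ
    constructor
    · rintro ⟨q, h⟩
      obtain ⟨q', h3, -⟩ := (hp _).1 h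
      exact ⟨q', h3⟩
    · rintro ⟨q, h⟩
      obtain ⟨i, rfl⟩ := h1 _ h
      exact ⟨.left i, (hp _).2 ⟨_, h, (hsteps _ _).2 rfl⟩⟩
  have hfin : ∀ γ : List (ZMod n × Fin k), (∃ q, NReach l (timed l).length (q, γ) ∧
      q ∈ (nfa n k).final) ↔ Path 0 L (γ.reverse ++ Y) := by
    intro γ
    rw [hend]
    refine (hun γ).trans ((hmid _).trans ((h2 _).trans ⟨?_, ?_⟩))
    · rintro ⟨i, γ', Y', h3, h4, h5⟩
      obtain ⟨h6, rfl⟩ := reach_zero_iff.1 h3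
      obtain rfl : i = 0 := by simpa [nfa] using h6
      have : γ.reverse ++ Y = Y' := by
        simpa using (congrArg List.reverse h5)
      rwa [this]
    · intro h
      exact ⟨0, [], _, reach_zero_iff.2 ⟨rfl, rfl⟩, h, by simp⟩
  constructor
  · rintro ⟨q, γ, h3, h4⟩
    have h5 := (hfin γ).1 ⟨q, h3, h4⟩
    have h6 := h5.length_eq
    rw [List.length_append, hY, List.length_reverse] at h6
    obtain rfl : γ = [] := List.length_eq_zero_iff.1 (by omega)
    simpa using h5
  · intro h
    obtain ⟨q, h3, h4⟩ := (hfin []).2 (by simpa using h)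
    exact ⟨q, [], h3, h4⟩

end Automaton

section Labels

theorem map_flatMap_congr {α β δ : Type} {f : α → List β} {g : β → δ}
    (h : ∀ x y, (f x).map g = (f y).map g) {l l' : List α} (hl : l.length = l'.length) :
    (l.flatMap f).map g = (l'.flatMap f).map g := by
  induction l generalizing l' with
  | nil =>
    obtain rfl := List.length_eq_zero_iff.1 hl.symm
    rfl
  | cons x l ih =>
    cases l' with
    | nil => simp at hl
    | cons y l' =>
      rw [List.flatMap_cons, List.flatMap_cons, List.map_append, List.map_append, h x y,
        ih (by simpa using hl)]

variable {n k : ℕ}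

theorem countP_call_of_neutral {s : List (Letter k)} (hs : ∀ a ∈ s, a.kind = .int) :
    s.countP (fun a => a.kind = .call) = 0 := by
  rw [List.countP_eq_zero]
  intro a ha
  simp [hs a ha]

variable [NeZero k]

theorem map_kind_rows (R S : Finset (ZMod n × ZMod n)) :
    (rows k R n).map Letter.kind = (rows k S n).map Letter.kind :=
  map_kind_eq_of_neutral (fun _ ha => kind_of_mem_rows ha) (fun _ ha => kind_of_mem_rows ha)
    (by simp [length_rows])

theorem map_kind_block [NeZero n] (b b' : Level n k) :
    (block b).map Letter.kind = (block b').map Letter.kind := by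
  have h1 : (core b).map Letter.kind = (core b').map Letter.kind :=
    map_kind_eq_of_neutral (fun a ha => kind_of_mem_core ha) (fun a ha => kind_of_mem_core ha)
      (by simp [core, length_rows])
  have h2 : (window b.mask).map Letter.kind = (window b'.mask).map Letter.kind :=
    map_kind_eq_of_neutral (fun a ha => kind_of_mem_window ha) (fun a ha => kind_of_mem_window ha)
      (by simp [length_window])
  simp [block, h1, h2]

theorem map_kind_unwind [NeZero n] (y y' : ZMod n × Fin k) :
    (unwind y).map Letter.kind = (unwind y').map Letter.kind := by
  have h1 : (query k y.1).map Letter.kind = (query k y'.1).map Letter.kind :=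
    map_kind_eq_of_neutral (fun a ha => kind_of_mem_query ha) (fun a ha => kind_of_mem_query ha)
      (by simp [length_query])
  have h2 : (window {y.2}).map Letter.kind = (window {y'.2}).map Letter.kind :=
    map_kind_eq_of_neutral (fun a ha => kind_of_mem_window ha) (fun a ha => kind_of_mem_window ha)
      (by simp [length_window])
  simp [unwind, h1, h2]

theorem countP_call_flatMap_block (L : List (Level n k)) :
    (L.flatMap block).countP (fun a => a.kind = .call) = L.length := by
  induction L with
  | nil => rfl
  | cons b L ih =>
    rw [List.flatMap_cons, List.countP_append, ih, block, List.countP_append, List.countP_append,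
      countP_call_of_neutral fun a ha => kind_of_mem_core ha,
      countP_call_of_neutral fun a ha => kind_of_mem_window ha]
    simp [Letter.kind, add_comm]

theorem kind_ne_ret_of_mem_flatMap_block {L : List (Level n k)} {a : Letter k}
    (ha : a ∈ L.flatMap block) : a.kind ≠ .ret := by
  obtain ⟨b, -, ha⟩ := List.mem_flatMap.1 ha
  simp only [block, List.mem_append, List.mem_singleton] at ha
  rcases ha with ha | ha | rfl
  · simp [kind_of_mem_core ha]
  · simp [kind_of_mem_window ha]
  · simp [Letter.kind]

end Labels

section Levels

variable {n k : ℕ} [NeZero n]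

/-- A level without restrictions. -/
def freeLevel (n k : ℕ) [NeZero n] : Level n k := ⟨Finset.univ, ∅, Finset.univ⟩

/-- Every row and every column of the relation is nonempty. -/
def FullRel (R : Finset (ZMod n × ZMod n)) : Prop :=
  (∀ i, ∃ j, (i, j) ∈ R) ∧ ∀ j, ∃ i, (i, j) ∈ R

/-- The pairs of a full relation and a nonempty set of event symbols. -/
abbrev FullPair (n k : ℕ) [NeZero n] : Type :=
  {R : Finset (ZMod n × ZMod n) // FullRel R} × {K : Finset (Fin k) // K.Nonempty}

/-- The level given by a full relation and a nonempty set of event symbols. -/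
def FullPair.level (p : FullPair n k) : Level n k := ⟨p.1.1, ∅, p.2.1⟩

theorem path_cons_level {p : FullPair n k} {L : List (Level n k)} {Y : List (ZMod n × Fin k)}
    {i j : ZMod n} {m : Fin k} : Path i (p.level :: L) ((j, m) :: Y) ↔
      ((i, j) ∈ p.1.1 ∧ m ∈ p.2.1) ∧ Path j L Y := by
  simp [Path, FullPair.level, and_assoc]

theorem exists_path (l : List (FullPair n k)) (i : ZMod n) :
    ∃ Y, Path i (l.map FullPair.level) Y := by
  induction l generalizing i with
  | nil => exact ⟨[], trivial⟩
  | cons p l ih =>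
    obtain ⟨j, hj⟩ := p.1.2.1 i
    obtain ⟨m, hm⟩ := p.2.2
    obtain ⟨Y, hY⟩ := ih j
    exact ⟨(j, m) :: Y, path_cons_level.2 ⟨⟨hj, hm⟩, hY⟩⟩

theorem FullPair.ext_of_mem {p p' : FullPair n k}
    (h : ∀ x m, (x ∈ p.1.1 ∧ m ∈ p.2.1) ↔ (x ∈ p'.1.1 ∧ m ∈ p'.2.1)) : p = p' := by
  have key : (p.1.1 ×ˢ p.2.1 : Finset _) = p'.1.1 ×ˢ p'.2.1 := by
    ext ⟨x, m⟩
    simpa using h x m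
  obtain ⟨j, hj⟩ := p.1.2.1 0
  obtain ⟨j', hj'⟩ := p'.1.2.1 0
  obtain ⟨m, hm⟩ := p.2.2
  obtain ⟨m', hm'⟩ := p'.2.2
  refine Prod.ext (Subtype.ext (Finset.ext fun x => ?_)) (Subtype.ext (Finset.ext fun a => ?_))
  · exact ⟨fun hx => ((h x m).1 ⟨hx, hm⟩).1, fun hx => ((h x m').2 ⟨hx, hm'⟩).1⟩
  · exact ⟨fun ha => ((h _ a).1 ⟨hj, ha⟩).2, fun ha => ((h _ a).2 ⟨hj', ha⟩).2⟩

theorem eq_of_path_iff {l l' : List (FullPair n k)} (hlen : l.length = l'.length)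
    (h : ∀ i Y, Path i (l.map FullPair.level) Y ↔ Path i (l'.map FullPair.level) Y) : l = l' := by
  induction l generalizing l' with
  | nil => exact (List.length_eq_zero_iff.1 hlen.symm).symm
  | cons p l ih =>
    cases l' with
    | nil => simp at hlen
    | cons p' l' =>
      simp only [List.map_cons] at h
      obtain rfl : p = p' := FullPair.ext_of_mem fun x m => by
        constructor
        · intro hx
          obtain ⟨Y, hY⟩ := exists_path l x.2
          exact (path_cons_level.1 ((h x.1 _).1 (path_cons_level.2 ⟨hx, hY⟩))).1
        · intro hx
          obtain ⟨Y, hY⟩ := exists_path l' x.2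
          exact (path_cons_level.1 ((h x.1 _).2 (path_cons_level.2 ⟨hx, hY⟩))).1
      rw [ih (by simpa using hlen) fun i Y => ?_]
      obtain ⟨j, hj⟩ := p.1.2.2 i
      obtain ⟨m, hm⟩ := p.2.2
      have := h j ((i, m) :: Y)
      rwa [path_cons_level, path_cons_level, and_iff_right ⟨hj, hm⟩, and_iff_right ⟨hj, hm⟩] at this

theorem card_nonempty_finset (k : ℕ) :
    Nat.card {K : Finset (Fin k) // K.Nonempty} = 2 ^ k - 1 := by
  classical
  rw [Nat.card_eq_fintype_card, Fintype.card_subtype]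
  have : (Finset.univ.filter fun K : Finset (Fin k) => K.Nonempty) = Finset.univ.erase ∅ := by
    ext K
    simp [Finset.nonempty_iff_ne_empty]
  rw [this, Finset.card_erase_of_mem (Finset.mem_univ _)]
  simp

theorem card_filter_fst_ne (i : ZMod n) :
    (Finset.univ.filter fun p : ZMod n × ZMod n => p.1 ≠ i).card = n * (n - 1) := by
  have : (Finset.univ.filter fun p : ZMod n × ZMod n => p.1 ≠ i) =
      (Finset.univ.erase i) ×ˢ Finset.univ := by
    ext p
    simp
  rw [this, Finset.card_product, Finset.card_erase_of_mem (Finset.mem_univ _)]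
  simp [ZMod.card, mul_comm]

theorem card_filter_snd_ne (i : ZMod n) :
    (Finset.univ.filter fun p : ZMod n × ZMod n => p.2 ≠ i).card = n * (n - 1) := by
  have : (Finset.univ.filter fun p : ZMod n × ZMod n => p.2 ≠ i) =
      Finset.univ ×ˢ (Finset.univ.erase i) := by
    ext p
    simp
  rw [this, Finset.card_product, Finset.card_erase_of_mem (Finset.mem_univ _)]
  simp [ZMod.card]

theorem card_relations (n : ℕ) [NeZero n] :
    Fintype.card (Finset (ZMod n × ZMod n)) = 2 ^ n ^ 2 := by
  simp [ZMod.card, sq]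

theorem le_card_fullRel :
    2 ^ n ^ 2 ≤ Nat.card {R : Finset (ZMod n × ZMod n) // FullRel R} +
      2 * n * 2 ^ (n * (n - 1)) := by
  classical
  rw [Nat.card_eq_fintype_card, Fintype.card_subtype, ← card_relations, ← Finset.card_univ]
  have hsub : (Finset.univ : Finset (Finset (ZMod n × ZMod n))) ⊆
      Finset.univ.filter FullRel ∪
      ((Finset.univ.biUnion fun i => (Finset.univ.filter fun p => p.1 ≠ i).powerset) ∪
      Finset.univ.biUnion fun i => (Finset.univ.filter fun p => p.2 ≠ i).powerset) := by
    intro R _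
    by_cases hR : FullRel R
    · exact Finset.mem_union_left _ (by simpa using hR)
    refine Finset.mem_union_right _ ?_
    rw [FullRel, not_and_or] at hR
    push Not at hR
    rcases hR with ⟨i, hi⟩ | ⟨i, hi⟩
    · refine Finset.mem_union_left _ (Finset.mem_biUnion.2 ⟨i, Finset.mem_univ _, ?_⟩)
      rw [Finset.mem_powerset]
      rintro ⟨x, y⟩ hxy
      simp only [Finset.mem_filter, Finset.mem_univ, true_and]
      rintro rfl
      exact hi y hxy
    · refine Finset.mem_union_right _ (Finset.mem_biUnion.2 ⟨i, Finset.mem_univ _, ?_⟩)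
      rw [Finset.mem_powerset]
      rintro ⟨x, y⟩ hxy
      simp only [Finset.mem_filter, Finset.mem_univ, true_and]
      rintro rfl
      exact hi x hxy
  refine (Finset.card_le_card hsub).trans ((Finset.card_union_le _ _).trans
    (Nat.add_le_add_left ((Finset.card_union_le _ _).trans ?_) _))
  have h1 := Finset.card_biUnion_le_card_mul (Finset.univ : Finset (ZMod n))
    (fun i => (Finset.univ.filter fun p : ZMod n × ZMod n => p.1 ≠ i).powerset)
    (2 ^ (n * (n - 1))) fun i _ => by rw [Finset.card_powerset, card_filter_fst_ne]
  have h2 := Finset.card_biUnion_le_card_mul (Finset.univ : Finset (ZMod n))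
    (fun i => (Finset.univ.filter fun p : ZMod n × ZMod n => p.2 ≠ i).powerset)
    (2 ^ (n * (n - 1))) fun i _ => by rw [Finset.card_powerset, card_filter_snd_ne]
  rw [Finset.card_univ, ZMod.card] at h1 h2
  linarith

end Levels

section LowerBounds

theorem le_of_forall_pow_le {N g C : ℕ} (h : ∀ d, N ^ d ≤ C * g ^ (d + 1)) : N ≤ g := by
  by_contra! hlt
  rcases Nat.eq_zero_or_pos g with rfl | hg
  · simpa using h 0
  have h1 : (1 : ℝ) < (N : ℝ) / g := by
    rw [one_lt_div (by exact_mod_cast hg)]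
    exact_mod_cast hlt
  obtain ⟨d, hd⟩ := pow_unbounded_of_one_lt ((C : ℝ) * g) h1
  have hg' : (0 : ℝ) < (g : ℝ) ^ d := by positivity
  rw [div_pow, lt_div_iff₀ hg'] at hd
  have h2 : ((N : ℝ)) ^ d ≤ C * g ^ (d + 1) := by exact_mod_cast h d
  rw [pow_succ] at h2
  linarith

variable {n k : ℕ} [NeZero n] [NeZero k]

/-- The deterministic automaton `B` accepts the same timed strings as the automaton `nfa n k`. -/
structure Recognizes {Q Γ : Type} (n k : ℕ) (B : ECIDPDA (Letter k) Q Γ) : Prop where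
  deterministic : B.Deterministic Letter.kind
  accepts_iff (w : List (Letter k × ℝ)) (hw : IsTimed w) :
    B.Accepts Letter.kind w ↔ (nfa n k).Accepts Letter.kind w

variable {Q Γ : Type} {B : ECIDPDA (Letter k) Q Γ}

theorem Recognizes.accepts_word (hB : Recognizes n k B) {L : List (Level n k)}
    {Y : List (ZMod n × Fin k)} (hK : ∀ b ∈ L, b.mask.Nonempty) (hY : Y.length = L.length)
    (hL : L ≠ []) : B.Accepts Letter.kind (timed (word L Y)) ↔ Path 0 L Y :=
  (hB.accepts_iff _ (isTimed_timed _)).trans (nfa_accepts_word hK hY hL)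

theorem exists_reach_open (hB : Recognizes n k B) {L : List (Level n k)}
    {Y₀ : List (ZMod n × Fin k)} (hK : ∀ b ∈ L, b.mask.Nonempty) (hL : L ≠ [])
    (hY₀ : Path 0 L Y₀) :
    ∃ c : Q × List Γ, c.2.length = L.length ∧ ∀ Y, Y.length = L.length →
      Reach Letter.kind B (timed (word L Y)) ((L.flatMap block).length + (pad n k).length) c := by
  obtain ⟨q, γ, h, -⟩ := (hB.accepts_word hK hY₀.length_eq hL).2 hY₀
  obtain ⟨c, hc⟩ := exists_reach_of_le
    (i := (L.flatMap block).length + (pad n k).length) (by simp [length_timed, word]) h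
  refine ⟨c, ?_, fun Y hY => ?_⟩
  · rw [word, ← List.append_assoc, ← List.length_append] at hc
    rw [length_stack (fun a ha => ?_) hc, List.countP_append, countP_call_flatMap_block,
      countP_call_of_neutral fun a ha => kind_of_mem_pad ha, add_zero]
    rcases List.mem_append.1 ha with ha | ha
    · exact kind_ne_ret_of_mem_flatMap_block ha
    · simp [kind_of_mem_pad ha]
  · rw [word, ← List.append_assoc, ← List.length_append] at hc ⊢
    exact reach_cut_left uniqueBrackets_kind mem_pad
      (map_flatMap_congr map_kind_unwind (by simp [hY, hY₀.length_eq])) hc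

theorem path_of_reach_open (hB : Recognizes n k B) {L L' : List (Level n k)}
    {Y : List (ZMod n × Fin k)} (hK : ∀ b ∈ L, b.mask.Nonempty) (hK' : ∀ b ∈ L', b.mask.Nonempty)
    (hLL' : L.length = L'.length) {c : Q × List Γ}
    (hc : ∀ Y, Y.length = L.length →
      Reach Letter.kind B (timed (word L Y)) ((L.flatMap block).length + (pad n k).length) c)
    (hc' : ∀ Y, Y.length = L'.length →
      Reach Letter.kind B (timed (word L' Y)) ((L'.flatMap block).length + (pad n k).length) c)
    (hL : L ≠ []) (h : Path 0 L Y) : Path 0 L' Y := by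
  have hY := h.length_eq
  have hmap : (L.flatMap block).map Letter.kind = (L'.flatMap block).map Letter.kind :=
    map_flatMap_congr map_kind_block hLL'
  have hlen : (L.flatMap block).length = (L'.flatMap block).length := by
    simpa only [List.length_map] using congrArg List.length hmap
  have hL' : L' ≠ [] := by
    rintro rfl
    exact hL (List.length_eq_zero_iff.1 hLL')
  rw [← hB.accepts_word hK' (hY.trans hLL') hL']
  exact accepts_of_reach_cut hB.deterministic uniqueBrackets_kind mem_pad hmap (hc Y hY)
    (hlen ▸ hc' Y (hY.trans hLL')) ((hB.accepts_word hK hY hL).2 h)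

theorem card_fullPair_pow_le [Finite Q] [Finite Γ] (hB : Recognizes n k B) (d : ℕ) :
    Nat.card (FullPair n k) ^ d ≤ Nat.card Q * Nat.card Γ ^ (d + 1) := by
  let L : List.Vector (FullPair n k) d → List (Level n k) :=
    fun p => freeLevel n k :: p.1.map FullPair.level
  have hlen : ∀ p, (L p).length = d + 1 := fun p => by simp [L, p.2]
  have hK : ∀ p, ∀ b ∈ L p, b.mask.Nonempty := by
    intro p b hb
    rcases List.mem_cons.1 hb with rfl | hb
    · exact ⟨0, Finset.mem_univ _⟩
    · obtain ⟨x, -, rfl⟩ := List.mem_map.1 hb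
      exact x.2.2
  have hpath : ∀ p i Y, Path 0 (L p) ((i, 0) :: Y) ↔ Path i (p.1.map FullPair.level) Y := by
    intro p i Y
    simp [L, Path, freeLevel]
  have hex : ∀ p, ∃ Y, Path 0 (L p) Y := by
    intro p
    obtain ⟨Y, hY⟩ := exists_path p.1 0
    exact ⟨_, (hpath p 0 Y).2 hY⟩
  choose c hc hreach using fun p => exists_reach_open hB (hK p) (List.cons_ne_nil _ _)
    (hex p).choose_spec
  let f : List.Vector (FullPair n k) d → Q × List.Vector Γ (d + 1) :=
    fun p => ((c p).1, ⟨(c p).2, (hc p).trans (hlen p)⟩)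
  have hf : Function.Injective f := by
    intro p p' hpp
    obtain ⟨h1, h2⟩ := Prod.mk.inj hpp
    have hcc : c p = c p' := Prod.ext h1 (congrArg Subtype.val h2)
    have hl : (L p).length = (L p').length := (hlen p).trans (hlen p').symm
    refine Subtype.ext (eq_of_path_iff (p.2.trans p'.2.symm) fun i Y => ?_)
    rw [← hpath, ← hpath]
    exact ⟨path_of_reach_open hB (hK p) (hK p') hl (hreach p) (hcc ▸ hreach p')
        (List.cons_ne_nil _ _),
      path_of_reach_open hB (hK p') (hK p) hl.symm (hreach p') (hcc ▸ hreach p)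
        (List.cons_ne_nil _ _)⟩
  have := Fintype.ofFinite Γ
  have := Fintype.ofFinite Q
  have := Fintype.ofFinite (FullPair n k)
  have := Fintype.card_le_of_injective f hf
  simpa only [Fintype.card_prod, card_vector, Nat.card_eq_fintype_card] using this

theorem card_fullPair_le [Finite Q] [Finite Γ] (hB : Recognizes n k B) :
    Nat.card (FullPair n k) ≤ Nat.card Γ :=
  le_of_forall_pow_le (card_fullPair_pow_le hB)

theorem stack_lower_bound [Finite Q] [Finite Γ] (hB : Recognizes n k B) :
    ((2 : ℤ) ^ n ^ 2 - 2 * n * 2 ^ (n * (n - 1))) * (2 ^ k - 1) ≤ (Nat.card Γ : ℤ) := by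
  have h := card_fullPair_le hB
  rw [Nat.card_prod, card_nonempty_finset] at h
  have hfull : (Nat.card {R : Finset (ZMod n × ZMod n) // FullRel R} : ℤ) * (2 ^ k - 1) ≤
      Nat.card Γ := by
    have := (Nat.cast_le (α := ℤ)).2 h
    rw [Nat.cast_mul, Nat.cast_sub Nat.one_le_two_pow] at this
    exact_mod_cast this
  have h2 : (2 : ℤ) ^ n ^ 2 ≤ Nat.card {R : Finset (ZMod n × ZMod n) // FullRel R} +
      2 * n * 2 ^ (n * (n - 1)) := by exact_mod_cast le_card_fullRel
  have h3 : (0 : ℤ) ≤ 2 ^ k - 1 := by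
    have : (1 : ℤ) ≤ 2 ^ k := one_le_pow₀ (by norm_num)
    linarith
  exact (mul_le_mul_of_nonneg_right (by linarith) h3).trans hfull

/-- The two-level string testing whether a pair belongs to the union of two relations. -/
def pairWord (R S : Finset (ZMod n × ZMod n)) (x : ZMod n × ZMod n) : List (Letter k) :=
  word [freeLevel n k, ⟨R, S, Finset.univ⟩] [(x.1, 0), (x.2, 0)]

/-- The part of `pairWord` up to the relation `R`. -/
def pairInit (k : ℕ) [NeZero k] (R : Finset (ZMod n × ZMod n)) : List (Letter k) :=
  block (freeLevel n k) ++ pad n k ++ (pad n k ++ rows k R n)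

/-- The part of `pairWord` starting with the relation `S`. -/
def pairTail (k : ℕ) [NeZero k] (S : Finset (ZMod n × ZMod n)) (x : ZMod n × ZMod n) :
    List (Letter k) :=
  rows k S n ++ (window Finset.univ ++ .op :: (pad n k ++ (pad n k ++
    [((x.2, 0) : ZMod n × Fin k), (x.1, 0)].flatMap unwind)))

theorem pairWord_eq (R S : Finset (ZMod n × ZMod n)) (x : ZMod n × ZMod n) :
    (pairWord R S x : List (Letter k)) =
      pairInit k R ++ (pad n k ++ (pad n k ++ pairTail k S x)) := by
  simp [pairWord, pairInit, pairTail, word, block, core]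

theorem map_kind_pairInit (R S : Finset (ZMod n × ZMod n)) :
    (pairInit k R).map Letter.kind = (pairInit k S).map Letter.kind := by
  simp [pairInit, map_kind_rows R S]

theorem map_kind_pairTail (R S : Finset (ZMod n × ZMod n)) (x y : ZMod n × ZMod n) :
    (pairTail k R x).map Letter.kind = (pairTail k S y).map Letter.kind := by
  simp [pairTail, map_kind_rows R S, map_kind_unwind (x.1, (0 : Fin k)) (y.1, 0),
    map_kind_unwind (x.2, (0 : Fin k)) (y.2, 0)]

theorem Recognizes.accepts_pairWord (hB : Recognizes n k B) (R S : Finset (ZMod n × ZMod n))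
    (x : ZMod n × ZMod n) :
    B.Accepts Letter.kind (timed (pairWord R S x)) ↔ x ∈ R ∨ x ∈ S := by
  rw [pairWord, hB.accepts_word (by simp [freeLevel, Finset.univ_nonempty]) rfl (by simp)]
  simp [Path, freeLevel]

theorem exists_reach_pairInit (hB : Recognizes n k B) (R : Finset (ZMod n × ZMod n)) :
    ∃ c : Q × List Γ, ∀ S x, Reach Letter.kind B (timed (pairWord R S x))
      ((pairInit k R).length + (pad n k).length) c := by
  obtain ⟨q, γ, h, -⟩ := (hB.accepts_pairWord R Finset.univ 0).2 (.inr (Finset.mem_univ _))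
  obtain ⟨c, hc⟩ := exists_reach_of_le
    (i := (pairInit k R).length + (pad n k).length) (by simp [length_timed, pairWord_eq]) h
  refine ⟨c, fun S x => ?_⟩
  rw [pairWord_eq, ← List.append_assoc, ← List.length_append] at hc ⊢
  exact reach_cut_left uniqueBrackets_kind mem_pad (map_kind_pairTail _ _ _ _) hc

/-- The stack contents before and after reading `R` are the same, and those before do not
depend on `R`. -/
theorem stack_eq_of_reach_pairInit (hB : Recognizes n k B) {R R' : Finset (ZMod n × ZMod n)}
    {c c' : Q × List Γ}
    (hc : ∀ S x, Reach Letter.kind B (timed (pairWord R S x))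
      ((pairInit k R).length + (pad n k).length) c)
    (hc' : ∀ S x, Reach Letter.kind B (timed (pairWord R' S x))
      ((pairInit k R').length + (pad n k).length) c') : c.2 = c'.2 := by
  set u : List (Letter k) := block (freeLevel n k) ++ pad n k with hu
  have hword : ∀ R : Finset (ZMod n × ZMod n), (pairWord R ∅ 0 : List (Letter k)) =
      u ++ (pad n k ++ (rows k R n ++ (pad n k ++ (pad n k ++ pairTail (n := n) k ∅ 0)))) := by
    intro R
    simp [pairWord_eq, pairInit, hu]
  have key : ∀ (R : Finset (ZMod n × ZMod n)) (c : Q × List Γ),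
      Reach Letter.kind B (timed (pairWord R ∅ 0)) ((pairInit k R).length + (pad n k).length) c →
      ∃ q, Reach Letter.kind B (timed (pairWord R ∅ 0)) u.length (q, c.2) := by
    intro R c hc
    refine reach_of_neutral (by simp [pairInit, hu]) (fun m p h1 h2 h3 => ?_) hc
    simp only [timed_getElem?, Option.map_eq_some_iff] at h3
    obtain ⟨a, ha, rfl⟩ := h3
    have hword' : (pairWord R ∅ 0 : List (Letter k)) =
        u ++ ((pad n k ++ (rows k R n ++ pad n k)) ++ (pad n k ++ pairTail (n := n) k ∅ 0)) := by
      simp [hword]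
    have hm : m - u.length < (pad n k ++ (rows k R n ++ pad n k)).length := by
      simp only [pairInit, ← hu, List.length_append] at h2 ⊢
      omega
    rw [hword', List.getElem?_append_right h1, List.getElem?_append_left hm] at ha
    have := List.mem_of_getElem? ha
    simp only [List.mem_append] at this
    rcases this with h | h | h
    · exact kind_of_mem_pad h
    · exact kind_of_mem_rows h
    · exact kind_of_mem_pad h
  obtain ⟨q, hq⟩ := key R c (hc ∅ 0)
  obtain ⟨q', hq'⟩ := key R' c' (hc' ∅ 0)
  rw [hword] at hq hq'
  have := reach_cut_left (v' := rows k R' n ++ (pad n k ++ (pad n k ++ pairTail (n := n) k ∅ 0)))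
    uniqueBrackets_kind mem_pad (by simp [map_kind_rows R R']) hq
  exact (Prod.mk.inj (Reach.unique hB.deterministic (isTimed_timed _) this hq')).2

theorem state_lower_bound [Finite Q] (hB : Recognizes n k B) : 2 ^ n ^ 2 ≤ Nat.card Q := by
  choose c hc using exists_reach_pairInit (Q := Q) (Γ := Γ) hB
  have aux : ∀ R R', c R = c R' → R ⊆ R' := by
    intro R R' h x hx
    have hlen : (pairInit k R).length = (pairInit k R').length := by
      simpa only [List.length_map] using congrArg List.length (map_kind_pairInit (k := k) R R')
    have hacc := (hB.accepts_pairWord R ∅ x).2 (.inl hx)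
    have h1 := hc R ∅ x
    have h2 := hc R' ∅ x
    rw [pairWord_eq] at hacc h1 h2
    rw [← h, ← hlen] at h2
    have := accepts_of_reach_cut hB.deterministic uniqueBrackets_kind mem_pad
      (map_kind_pairInit R R') h1 h2 hacc
    rw [← pairWord_eq, hB.accepts_pairWord] at this
    simpa using this
  have hinj : Function.Injective fun R => (c R).1 := by
    intro R R' h
    have hcc : c R = c R' := Prod.ext h (stack_eq_of_reach_pairInit hB (hc R) (hc R'))
    exact (aux R R' hcc).antisymm (aux R' R hcc.symm)
  rw [← card_relations, ← Nat.card_eq_fintype_card]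
  exact Nat.card_le_card_of_injective _ hinj

end LowerBounds

end ECIDPDALowerBound

/-- **Lower bound on determinization complexity of ECIDPDA.**
There is an absolute constant `C` (independent of `n` and `k`) such
that for all `n, k ≥ 1` there is a nondeterministic event-clock
input-driven pushdown automaton with at most `C·n` states, over an
alphabet of size `k + 5`, with `n·k` stack symbols and `k` atomic clock
constraints referring only to symbol history clocks, such that every
deterministic ECIDPDA recognizing the same set of timed strings has at
least `2^(n²)` states and at least `(2^(n²) − 2n·2^(n(n−1)))·(2^k − 1)`
stack symbols. -/
theorem ecidpda_determinization_lower_bound :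
    ∃ C : ℕ, ∀ n k : ℕ, 1 ≤ n → 1 ≤ k →
      ∃ (A : Type) (lab : A → SymbolKind), Nat.card A = k + 5 ∧
      ∃ (Q : Type) (_ : Finite Q), Nat.card Q ≤ C * n ∧
      ∃ (Γ : Type) (_ : Finite Γ), Nat.card Γ = n * k ∧
      ∃ M : ECIDPDA A Q Γ,
        (∃ Ψ : Finset (ClockConstraint A), Ψ.card = k ∧
          (∀ φ ∈ Ψ, ∃ (a : A) (τ : ℝ),
            φ = ClockConstraint.le (Clock.histS a) τ ∨
            φ = ClockConstraint.ge (Clock.histS a) τ) ∧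
          M.atomicSet ⊆ ↑Ψ) ∧
        ∀ (Q' Γ' : Type), Finite Q' → Finite Γ' →
          ∀ B : ECIDPDA A Q' Γ', ECIDPDA.Deterministic lab B →
          (∀ w : List (A × ℝ), IsTimed w →
            (ECIDPDA.Accepts lab B w ↔ ECIDPDA.Accepts lab M w)) →
          2 ^ n ^ 2 ≤ Nat.card Q' ∧
          ((2 : ℤ) ^ n ^ 2 - 2 * n * 2 ^ (n * (n - 1))) * (2 ^ k - 1) ≤
            (Nat.card Γ' : ℤ) := by
  refine ⟨4, fun n k hn hk => ?_⟩
  have : NeZero n := ⟨by omega⟩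
  have : NeZero k := ⟨by omega⟩
  open ECIDPDALowerBound in
  refine ⟨Letter k, Letter.kind, card_letter k, St n, .of_equiv _ (stEquiv n).symm, ?_,
    ZMod n × Fin k, inferInstance, by simp, nfa n k,
    ⟨Finset.univ.map ⟨atom, atom_injective⟩, by simp, ?_, ?_⟩, ?_⟩
  · simp only [Nat.card_congr (stEquiv n), Nat.card_sum, Nat.card_zmod, Nat.card_unique]
    omega
  · intro φ hφ
    obtain ⟨m, -, rfl⟩ := Finset.mem_map.1 hφ
    exact ⟨_, _, .inl rfl⟩
  · simpa using nfa_atomicSet_subset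
  · intro Q' Γ' _ _ B hB hacc
    exact ⟨state_lower_bound ⟨hB, hacc⟩, stack_lower_bound ⟨hB, hacc⟩⟩
end

section
/- For every n ≥ 1 and k ≥ 1, there exists a nondeterministic event-clock input-driven pushdown automaton using at most C·n states (for an absolute constant C independent of n and k), nk stack symbols (the pairs (s, e) with s ∈ {0,…,n−1} and e ∈ {e₁,…,e_k}), and k atomic clock constraints, each of the form ◁e_i < 1 for a symbol history clock, which accepts every valid well-formed timed string and does not accept any invalid well-formed timed string. -/
/-- The alphabet `Σ₊₁ = {<}`, `Σ₋₁ = {>}`,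
`Σ₀ = {a, b, c, #} ∪ {e₁, …, e_k}` used in the lower bound. -/
inductive Alph (k : ℕ) : Type
  | lt | gt | a | b | c | hash
  | e (i : Fin k)
  deriving DecidableEq

/-- `<` is a left bracket, `>` is a right bracket, the rest are neutral. -/
def symLab {k : ℕ} : Alph k → SymbolKind
  | .lt => SymbolKind.call
  | .gt => SymbolKind.ret
  | _ => SymbolKind.int

/-- The pairs of a relation `R ⊆ {0,…,n−1}²` listed in lexicographical
order. -/
def pairList (n : ℕ) (R : Finset (Fin n × Fin n)) : List (Fin n × Fin n) :=
  (List.finRange n).flatMap fun i =>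
    (List.finRange n).filterMap fun j => if (i, j) ∈ R then some (i, j) else none

/-- The encoding `u_R = #a^{i₁}b^{j₁} #a^{i₂}b^{j₂} … #a^{i_ℓ}b^{j_ℓ}`
of a relation `R ⊆ {0,…,n−1}²`, its pairs listed in lexicographical
order. -/
def uEnc {k : ℕ} (n : ℕ) (R : Finset (Fin n × Fin n)) : List (Alph k) :=
  (pairList n R).flatMap fun p =>
    Alph.hash :: (List.replicate (p.1 : ℕ) Alph.a ++ List.replicate (p.2 : ℕ) Alph.b)

/-- The encoding `v_X = e₁…e_k e_{i₁}…e_{i_ℓ}` of a set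
`X ⊆ {e₁,…,e_k}`: first all `k` symbols, then the symbols of `X`. -/
def vEnc {k : ℕ} (X : Finset (Fin k)) : List (Alph k) :=
  ((List.finRange k).map Alph.e) ++ (X.sort (· ≤ ·)).map Alph.e

/-- A timed version of `v_X` relative to the time `τ` of the following
bracket: the underlying string is `v_X`, its first `k` symbols occur
more than 1 time unit before the bracket, and the remaining symbols
(those listing `X`) occur less than 1 time unit before it. -/
def TimedV {k : ℕ} (X : Finset (Fin k)) (τ : ℝ) (tv : List (Alph k × ℝ)) : Prop :=
  tv.map Prod.fst = vEnc X ∧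
  (∀ p ∈ tv.take k, p.2 < τ - 1) ∧
  (∀ p ∈ tv.drop k, τ - 1 < p.2 ∧ p.2 < τ)

/-- The parameters of a well-formed string: the number of levels
`m ≥ 1`, numbers `s₁,…,s_{m+1} ∈ {0,…,n−1}` (zero-indexed as
`s 0, …, s m`), relations `R₁,…,R_m ⊆ {0,…,n−1}²` and sets
`X₁,Y₁,…,X_m,Y_m ⊆ {e₁,…,e_k}`. -/
structure WFData (n k : ℕ) where
  m : ℕ
  hm : 1 ≤ m
  s : Fin (m + 1) → Fin n
  R : Fin m → Finset (Fin n × Fin n)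
  X : Fin m → Finset (Fin k)
  Y : Fin m → Finset (Fin k)

/-- A well-formed string is valid if `(s_i, s_{i+1}) ∈ R_i` for each
`i ∈ {1,…,m}` and `X_i ∩ Y_i ≠ ∅` for each `i ∈ {1,…,m}`. -/
def WFData.Valid {n k : ℕ} (d : WFData n k) : Prop :=
  (∀ i : Fin d.m, (d.s i.castSucc, d.s i.succ) ∈ d.R i) ∧
  (∀ i : Fin d.m, (d.X i ∩ d.Y i).Nonempty)

/-- `Realizes d w` : `w` is a well-formed timed string with parameters
`d`, i.e., a timed string whose underlying string is
`v_{X₁} < u_{R₁} … v_{X_m} < u_{R_m} c^{s_{m+1}} v_{Y_m} > c^{s_m} …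
v_{Y₁} > c^{s₁}`, in which, in each `v_{X_i}` (resp. `v_{Y_i}`), the
first `k` symbols occur more than 1 time unit before the following left
(resp. right) bracket, while the remaining symbols occur less than 1
time unit before it. -/
def Realizes {n k : ℕ} (d : WFData n k) (w : List (Alph k × ℝ)) : Prop :=
  IsTimed w ∧
  ∃ (tv tu tw : Fin d.m → List (Alph k × ℝ))
    (tc : Fin (d.m + 1) → List (Alph k × ℝ)) (τ σ : Fin d.m → ℝ),
    (∀ i, TimedV (d.X i) (τ i) (tv i)) ∧
    (∀ i, (tu i).map Prod.fst = uEnc n (d.R i)) ∧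
    (∀ i, TimedV (d.Y i) (σ i) (tw i)) ∧
    (∀ j, (tc j).map Prod.fst = List.replicate ((d.s j : ℕ)) Alph.c) ∧
    w = ((List.finRange d.m).flatMap fun i => tv i ++ [(Alph.lt, τ i)] ++ tu i)
        ++ tc (Fin.last d.m)
        ++ ((List.finRange d.m).reverse.flatMap fun i =>
              tw i ++ [(Alph.gt, σ i)] ++ tc i.castSucc)

/-- The abbreviation `C < τ`, standing for `(C ≤ τ) ∧ ¬(C ≥ τ)`. -/
def cLt {A : Type} (C : Clock A) (τ : ℝ) : ClockConstraint A :=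
  (ClockConstraint.le C τ).and ((ClockConstraint.ge C τ).not)

namespace LowerBoundAutomaton

/-- The phases of the automaton: keeping a number, looking for a pair with a given first
component, and counting the symbols `a`, then `b`, of the chosen pair. -/
inductive Phase : Type
  | keep | seek | cntA | cntB
  deriving DecidableEq

instance : Fintype Phase where
  elems := {.keep, .seek, .cntA, .cntB}
  complete x := by cases x <;> simp

/-- The states of the automaton: a phase and a number. -/
abbrev State (n : ℕ) : Type := Phase × Fin n

/-- A state which holds the value `j` once the current block of symbols `a` and `b` is over. -/
def Live {n : ℕ} (q : State n) (j : ℕ) : Prop :=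
  q.2.val = j ∧ (q.1 = .keep ∨ q.1 = .cntB ∨ (q.1 = .cntA ∧ j = 0))

/-- The transitions on neutral symbols. -/
inductive Step {n k : ℕ} : Alph k → State n → State n → Prop
  | seekA (s : Fin n) : Step .a (.seek, s) (.seek, s)
  | seekB (s : Fin n) : Step .b (.seek, s) (.seek, s)
  | seekHash (s : Fin n) : Step .hash (.seek, s) (.seek, s)
  | choose (s : Fin n) : Step .hash (.seek, s) (.cntA, s)
  | countA {r r' : Fin n} : r.val = r'.val + 1 → Step .a (.cntA, r) (.cntA, r')
  | countB {q : State n} {r' : Fin n} {j : ℕ} : Live q j → q.1 ≠ .keep → r'.val = j + 1 →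
      Step .b q (.cntB, r')
  | keepA (j : Fin n) : Step .a (.keep, j) (.keep, j)
  | keepB (j : Fin n) : Step .b (.keep, j) (.keep, j)
  | doneHash {q : State n} {j : Fin n} : Live q j → Step .hash q (.keep, j)
  | doneE {q : State n} {j : Fin n} (i : Fin k) : Live q j → Step (.e i) q (.keep, j)
  | countC {q : State n} {j : Fin n} : Live q (j.val + 1) → Step .c q (.keep, j)

/-- The computations on strings of neutral symbols. -/
def Run {n k : ℕ} : List (Alph k) → State n → State n → Prop
  | [], q, p => q = p
  | z :: v, q, p => ∃ r, Step z q r ∧ Run v r p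

/-- The automaton: on `<` it pushes the number it holds along with a guessed element of `X`, then
it seeks a pair of the relation starting with this number and holds its second component; each
symbol `c` decrements the number, which must be zero on `>`. -/
def automaton (n k : ℕ) : ECIDPDA (Alph k) (State n) (Fin n × Fin k) where
  init := {q | q.1 = .keep}
  final := {q | Live q 0}
  δint z q φ := {q' | φ = .tt ∧ Step z q q'}
  δcall _ q φ := {r | φ = cLt (.histS (.e r.2.2)) 1 ∧ q = (.keep, r.2.1) ∧ r.1 = (.seek, r.2.1)}
  δret _ g q φ := {q' | ∃ s, g = some s ∧ φ = cLt (.histS (.e s.2)) 1 ∧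
    q.1 = .keep ∧ q.2.val = 0 ∧ q' = (.keep, s.1)}

section Runs

variable {n k : ℕ}

theorem run_append {u v : List (Alph k)} {q q' : State n} :
    Run (u ++ v) q q' ↔ ∃ q₁, Run u q q₁ ∧ Run v q₁ q' := by
  induction u generalizing q with
  | nil => simp [Run]
  | cons z u ih =>
    simp only [List.cons_append, Run, ih]
    constructor
    · rintro ⟨q₁, h, q₂, h₁, h₂⟩
      exact ⟨q₂, ⟨q₁, h, h₁⟩, h₂⟩
    · rintro ⟨q₂, ⟨q₁, h, h₁⟩, h₂⟩
      exact ⟨q₁, h, q₂, h₁, h₂⟩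

theorem Live.unique {q : State n} {i j : ℕ} (h : Live q i) (h' : Live q j) : i = j :=
  h.1.symm.trans h'.1

@[simp]
theorem live_keep {x : Fin n} {j : ℕ} : Live (.keep, x) j ↔ x.val = j := by
  simp [Live]

theorem Step.ne_seek {z : Alph k} {q q' : State n} (h : Step z q q') (hq : q.1 ≠ .seek) :
    q'.1 ≠ .seek := by
  cases h <;> simp_all

theorem Run.ne_seek {v : List (Alph k)} {q q' : State n} (h : Run v q q') (hq : q.1 ≠ .seek) :
    q'.1 ≠ .seek := by
  induction v generalizing q with
  | nil => cases h; exact hq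
  | cons z v ih =>
    obtain ⟨q₁, h₁, h⟩ := h
    exact ih h (h₁.ne_seek hq)

/-- The encoding of z list of pairs. -/
def pairEnc (L : List (Fin n × Fin n)) : List (Alph k) :=
  L.flatMap fun p =>
    Alph.hash :: (List.replicate (p.1 : ℕ) Alph.a ++ List.replicate (p.2 : ℕ) Alph.b)

theorem mem_pairEnc {L : List (Fin n × Fin n)} {x : Alph k} (h : x ∈ pairEnc L) :
    x = .hash ∨ x = .a ∨ x = .b := by
  simp only [pairEnc, List.mem_flatMap, List.mem_cons, List.mem_append, List.mem_replicate] at h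
  tauto

theorem step_keep {x : Alph k} (hx : x = .hash ∨ x = .a ∨ x = .b) {j : Fin n} {q : State n} :
    Step x (.keep, j) q ↔ q = (.keep, j) := by
  constructor
  · intro h
    rcases hx with rfl | rfl | rfl <;> cases h <;> simp_all [Fin.ext_iff]
  · rintro rfl
    rcases hx with rfl | rfl | rfl
    · exact .doneHash (by simp)
    · exact .keepA j
    · exact .keepB j

theorem run_keep {v : List (Alph k)} (hv : ∀ x ∈ v, x = .hash ∨ x = .a ∨ x = .b) {j : Fin n}
    {q : State n} : Run v (.keep, j) q ↔ q = (.keep, j) := by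
  induction v with
  | nil => simp [Run, eq_comm]
  | cons z v ih =>
    simp only [List.mem_cons, forall_eq_or_imp] at hv
    simp [Run, step_keep hv.1, ih hv.2]

theorem run_seek {v : List (Alph k)} (hv : ∀ x ∈ v, x = .a ∨ x = .b) {s : Fin n}
    {q : State n} : Run v (.seek, s) q ↔ q = (.seek, s) := by
  induction v with
  | nil => simp [Run, eq_comm]
  | cons z v ih =>
    simp only [List.mem_cons, forall_eq_or_imp] at hv
    have hs : ∀ q₁, Step z (.seek, s) q₁ ↔ q₁ = (.seek, s) := by
      intro q₁
      constructor
      · intro h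
        rcases hv.1 with rfl | rfl <;> cases h <;> simp_all [Live]
      · rintro rfl
        rcases hv.1 with rfl | rfl
        · exact .seekA s
        · exact .seekB s
    simp [Run, hs, ih hv.2]

theorem exists_run_pairEnc_live {L : List (Fin n × Fin n)} {q : State n} {j : ℕ}
    (hq : q.1 ≠ .seek) :
    (∃ q', Run (k := k) (pairEnc L) q q' ∧ Live q' j) ↔ Live q j := by
  cases L with
  | nil => simp [pairEnc, Run]
  | cons p L =>
    set v : List (Alph k) :=
      List.replicate (p.1 : ℕ) Alph.a ++ List.replicate (p.2 : ℕ) Alph.b ++ pairEnc L with hv_def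
    have hL : pairEnc (p :: L) = Alph.hash :: v := by simp [pairEnc, hv_def]
    have hv : ∀ x ∈ v, x = .hash ∨ x = .a ∨ x = .b := fun x hx =>
      mem_pairEnc (L := p :: L) (by rw [hL]; exact List.mem_cons_of_mem _ hx)
    rw [hL]
    constructor
    · rintro ⟨q', ⟨q₁, h₁, h⟩, hj⟩
      cases h₁ with
      | seekHash => exact absurd rfl hq
      | choose => exact absurd rfl hq
      | doneHash h₁ =>
        rw [run_keep hv] at h
        subst h
        rw [live_keep] at hj
        exact hj ▸ h₁
    · intro h
      obtain rfl := h.1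
      exact ⟨_, ⟨_, .doneHash h, (run_keep hv).2 rfl⟩, by simp⟩

theorem exists_run_b {q : State n} {m i j : ℕ} (hq : q.1 ≠ .keep) (hi : Live q i) :
    (∃ q', Run (k := k) (List.replicate m .b) q q' ∧ Live q' j) ↔ j < n ∧ i + m = j := by
  induction m generalizing q i with
  | zero =>
    simp only [List.replicate_zero, Run, exists_eq_left', add_zero]
    constructor
    · intro h
      exact ⟨h.1 ▸ q.2.isLt, hi.unique h⟩
    · rintro ⟨-, rfl⟩
      exact hi
  | succ m ih =>
    simp only [List.replicate_succ, Run]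
    constructor
    · rintro ⟨q', ⟨q₁, h₁, h⟩, hj⟩
      cases h₁ with
      | seekB => simp [Live] at hi
      | keepB => exact absurd rfl hq
      | countB h₁ _ h₂ =>
        have := hi.unique h₁
        have := (ih (i := i + 1) (by simp) (by simp [Live]; omega)).1 ⟨q', h, hj⟩
        omega
    · rintro ⟨hj, h⟩
      obtain ⟨q', h₁, h₂⟩ := (ih (q := (.cntB, ⟨i + 1, by omega⟩)) (i := i + 1)
        (by simp) (by simp [Live])).2 ⟨hj, by omega⟩
      exact ⟨q', ⟨_, .countB hi hq rfl, h₁⟩, h₂⟩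

theorem exists_run_b_of_pos {s : Fin n} {m j : ℕ} (hs : s.val ≠ 0) :
    ¬ ∃ q', Run (k := k) (List.replicate m .b) (.cntA, s) q' ∧ Live q' j := by
  cases m with
  | zero =>
    simp only [List.replicate_zero, Run, exists_eq_left', Live]
    rintro ⟨rfl, h⟩
    simp_all
  | succ m =>
    rintro ⟨q', ⟨q₁, h₁, -⟩, -⟩
    cases h₁ with
    | countB h _ _ =>
      obtain ⟨rfl, h⟩ := h
      simp_all

theorem run_a {i : ℕ} {s : Fin n} {q : State n} :
    Run (k := k) (List.replicate i .a) (.cntA, s) q ↔ q.1 = .cntA ∧ s.val = q.2.val + i := by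
  induction i generalizing s with
  | zero =>
    rcases q with ⟨p, r⟩
    simp [Run, Fin.ext_iff, eq_comm]
  | succ i ih =>
    simp only [List.replicate_succ, Run]
    constructor
    · rintro ⟨q₁, h₁, h⟩
      cases h₁ with
      | countA h₁ =>
        rw [ih] at h
        exact ⟨h.1, by omega⟩
    · rintro ⟨h, h'⟩
      exact ⟨(.cntA, ⟨s.val - 1, by omega⟩), .countA (by simp; omega), ih.2 ⟨h, by simp; omega⟩⟩

theorem exists_run_cntA {i m j : ℕ} {s : Fin n} (hj : m < n) :
    (∃ q', Run (k := k) (List.replicate i .a ++ List.replicate m .b) (.cntA, s) q' ∧ Live q' j) ↔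
      s.val = i ∧ m = j := by
  constructor
  · rintro ⟨q', h, h'⟩
    obtain ⟨⟨p, r⟩, h₁, h₂⟩ := run_append.1 h
    obtain ⟨rfl, h₁⟩ := run_a.1 h₁
    by_cases hr : r.val = 0
    · have := (exists_run_b (by simp) (i := 0) (by simp [Live, hr])).1 ⟨q', h₂, h'⟩
      simp only at h₁
      omega
    · exact absurd ⟨q', h₂, h'⟩ (exists_run_b_of_pos hr)
  · rintro ⟨rfl, rfl⟩
    obtain ⟨q', h₁, h₂⟩ := (exists_run_b (k := k) (q := ((.cntA, ⟨0, by omega⟩) : State n))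
      (m := m) (j := m) (by simp) (i := 0) (by simp [Live])).2 ⟨hj, by simp⟩
    exact ⟨q', run_append.2 ⟨_, run_a.2 ⟨rfl, by simp⟩, h₁⟩, h₂⟩

theorem exists_run_pairEnc_seek {L : List (Fin n × Fin n)} {s : Fin n} {j : ℕ} :
    (∃ q', Run (k := k) (pairEnc L) (.seek, s) q' ∧ Live q' j) ↔
      ∃ y : Fin n, y.val = j ∧ (s, y) ∈ L := by
  induction L with
  | nil => simp [pairEnc, Run, Live]
  | cons p L ih =>
    obtain ⟨x, y⟩ := p
    have hL : pairEnc ((x, y) :: L) = Alph.hash ::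
        ((List.replicate (x : ℕ) Alph.a ++ List.replicate (y : ℕ) Alph.b) ++
          pairEnc (k := k) L) := by
      simp [pairEnc]
    have hab : ∀ z ∈ List.replicate (x : ℕ) (Alph.a (k := k)) ++
        List.replicate (y : ℕ) Alph.b, z = .a ∨ z = .b := by
      intro z hz
      simp only [List.mem_append, List.mem_replicate] at hz
      tauto
    have hmem : (∃ z : Fin n, z.val = j ∧ (s, z) ∈ (x, y) :: L) ↔
        (s.val = x ∧ y.val = j) ∨ ∃ z : Fin n, z.val = j ∧ (s, z) ∈ L := by
      simp only [List.mem_cons, Prod.mk.injEq, Fin.ext_iff]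
      constructor
      · rintro ⟨z, h, h' | h'⟩
        · exact .inl ⟨h'.1, h'.2 ▸ h⟩
        · exact .inr ⟨z, h, h'⟩
      · rintro (⟨h, h'⟩ | ⟨z, h, h'⟩)
        · exact ⟨y, h', .inl ⟨h, rfl⟩⟩
        · exact ⟨z, h, .inr h'⟩
    rw [hmem, ← ih, ← exists_run_cntA (k := k) y.isLt, hL]
    constructor
    · rintro ⟨q', ⟨q₁, h₁, h⟩, hj⟩
      obtain ⟨q₂, h₂, h₃⟩ := run_append.1 h
      cases h₁ with
      | seekHash =>
        rw [run_seek hab] at h₂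
        subst h₂
        exact .inr ⟨q', h₃, hj⟩
      | choose =>
        exact .inl ⟨q₂, h₂, (exists_run_pairEnc_live (h₂.ne_seek (by simp))).1 ⟨q', h₃, hj⟩⟩
      | doneHash h₁ => simp [Live] at h₁
    · rintro (⟨q', h, hj⟩ | ⟨q', h, hj⟩)
      · obtain ⟨q₂, h₂, h₃⟩ :=
          (exists_run_pairEnc_live (k := k) (L := L) (h.ne_seek (by simp))).2 hj
        exact ⟨q₂, ⟨_, .choose s, run_append.2 ⟨q', h, h₂⟩⟩, h₃⟩
      · exact ⟨q', ⟨_, .seekHash s, run_append.2 ⟨_, (run_seek hab).2 rfl, h⟩⟩, hj⟩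

theorem exists_run_uEnc {R : Finset (Fin n × Fin n)} {s : Fin n} {j : ℕ} :
    (∃ q', Run (k := k) (uEnc n R) (.seek, s) q' ∧ Live q' j) ↔
      ∃ y : Fin n, y.val = j ∧ (s, y) ∈ R := by
  have := exists_run_pairEnc_seek (k := k) (L := pairList n R) (s := s) (j := j)
  simpa [pairList, pairEnc, uEnc] using this

theorem run_e {l : List (Fin k)} (hl : l ≠ []) {q q' : State n} :
    Run (l.map Alph.e) q q' ↔ Live q q'.2 ∧ q'.1 = .keep := by
  induction l generalizing q with
  | nil => exact absurd rfl hl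
  | cons x l ih =>
    have hs : ∀ q₁ : State n, Step (.e x) q q₁ ↔ Live q q₁.2 ∧ q₁.1 = .keep := by
      intro q₁
      constructor
      · rintro ⟨⟩
        exact ⟨‹_›, rfl⟩
      · rcases q₁ with ⟨p, j⟩
        rintro ⟨h, rfl⟩
        exact .doneE x h
    by_cases hl' : l = []
    · simp [hl', Run, hs]
    · simp only [List.map_cons, Run, hs, ih hl']
      constructor
      · rintro ⟨⟨p, j⟩, ⟨h, rfl⟩, h', h''⟩
        rw [live_keep] at h'
        exact ⟨h' ▸ h, h''⟩
      · rintro ⟨h, h'⟩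
        exact ⟨q', ⟨h, h'⟩, ⟨rfl, .inl h'⟩, h'⟩

theorem run_vEnc (hk : 1 ≤ k) {X : Finset (Fin k)} {q q' : State n} :
    Run (vEnc X) q q' ↔ Live q q'.2 ∧ q'.1 = .keep := by
  rw [vEnc, ← List.map_append]
  refine run_e fun h => ?_
  have := congrArg List.length h
  simp at this
  omega

theorem run_c {q : State n} {m j : ℕ} :
    (∃ q', Run (k := k) (List.replicate m .c) q q' ∧ Live q' j) ↔ Live q (m + j) := by
  induction m generalizing q with
  | zero => simp [Run]
  | succ m ih =>
    simp only [List.replicate_succ, Run]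
    constructor
    · rintro ⟨q', ⟨q₁, h₁, h⟩, hj⟩
      have := ih.1 ⟨q', h, hj⟩
      cases h₁ with
      | countC h₁ =>
        rw [live_keep] at this
        rw [this] at h₁
        convert h₁ using 1
        omega
    · intro h
      have hlt : m + j < n := by have := h.1; omega
      obtain ⟨q', h₁, h₂⟩ := (ih (q := (.keep, ⟨m + j, hlt⟩))).2 (by simp)
      exact ⟨q', ⟨_, .countC (by convert h using 1; simp; omega), h₁⟩, h₂⟩

end Runs

section Infixes

variable {α : Type*} {w u v : List α} {i : ℕ}

theorem append_prefix_drop : u ++ v <+: w.drop i ↔ u <+: w.drop i ∧ v <+: w.drop (i + u.length) := by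
  constructor
  · rintro ⟨t, h⟩
    refine ⟨⟨v ++ t, by rw [← h]; simp⟩, ⟨t, ?_⟩⟩
    rw [← List.drop_drop, ← h]
    simp
  · rintro ⟨⟨t, h⟩, ⟨t', h'⟩⟩
    rw [← List.drop_drop, ← h] at h'
    simp only [List.drop_left] at h'
    exact ⟨t', by rw [← h, ← h']; simp⟩

theorem getElem?_of_prefix_drop (h : v <+: w.drop i) {x : ℕ} (hx : x < v.length) :
    w[i + x]? = v[x]? := by
  obtain ⟨t, h⟩ := h
  rw [← List.getElem?_drop, ← h, List.getElem?_append_left hx]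

theorem exists_last_occurrence {A : Type*} {a : A} {l : List (A × ℝ)} (h : a ∈ l.map Prod.fst) :
    ∃ l₁ t l₂, l = l₁ ++ (a, t) :: l₂ ∧ a ∉ l₂.map Prod.fst := by
  induction l with
  | nil => simp at h
  | cons p l ih =>
    by_cases hl : a ∈ l.map Prod.fst
    · obtain ⟨l₁, t, l₂, rfl, h₂⟩ := ih hl
      exact ⟨p :: l₁, t, l₂, rfl, h₂⟩
    · obtain rfl : a = p.1 := by simpa [hl] using h
      exact ⟨[], p.2, l, rfl, hl⟩

end Infixes

section Clocks

theorem clockVal_histS {A : Type} {lab : A → SymbolKind} {w l₁ l₂ : List (A × ℝ)} {i : ℕ}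
    {a b : A} {t τ v : ℝ} (h : l₁ ++ (a, t) :: l₂ ++ [(b, τ)] <+: w.drop i)
    (h₂ : a ∉ l₂.map Prod.fst) :
    ClockVal lab w (i + (l₁ ++ (a, t) :: l₂).length) (.histS a) v ↔ v = τ - t := by
  have hp : w[i + (l₁ ++ (a, t) :: l₂).length]? = some (b, τ) := by
    rw [getElem?_of_prefix_drop h (by simp)]
    simp
  have ht : w[i + l₁.length]? = some (a, t) := by
    rw [getElem?_of_prefix_drop h (by simp)]
    simp
  have hl : ∀ (j : ℕ) (p : A × ℝ), i + l₁.length < j → j < i + (l₁ ++ (a, t) :: l₂).length →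
      w[j]? = some p → p.1 ≠ a := by
    rintro j p hj hj' hw rfl
    obtain ⟨x, rfl⟩ := Nat.exists_eq_add_of_lt hj
    apply h₂
    rw [show i + l₁.length + x + 1 = i + (l₁.length + (x + 1)) by omega,
      getElem?_of_prefix_drop h (by simp at hj' ⊢; omega), List.append_assoc,
      List.getElem?_append_right (by omega)] at hw
    simp only [Nat.add_sub_cancel_left, List.cons_append, List.getElem?_cons_succ] at hw
    rw [List.getElem?_append_left (by simp at hj'; omega)] at hw
    exact List.mem_map_of_mem (List.mem_of_getElem? hw)
  constructor
  · rintro ⟨pi, pj, j, hpi, hj, hpj, ha, hlast, rfl⟩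
    obtain rfl := Option.some.inj (hp.symm.trans hpi)
    have : j = i + l₁.length := by
      rcases lt_trichotomy j (i + l₁.length) with hlt | heq | hlt
      · exact absurd rfl (hlast _ _ hlt (by simp) ht)
      · exact heq
      · exact absurd ha (hl j pj hlt hj hpj)
    subst this
    obtain rfl := Option.some.inj (ht.symm.trans hpj)
    rfl
  · rintro rfl
    exact ⟨(b, τ), (a, t), _, hp, by simp, ht, rfl, hl, rfl⟩

theorem sat_cLt {A : Type} {lab : A → SymbolKind} {w l₁ l₂ : List (A × ℝ)} {i : ℕ}
    {a b : A} {t τ c : ℝ} (h : l₁ ++ (a, t) :: l₂ ++ [(b, τ)] <+: w.drop i)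
    (h₂ : a ∉ l₂.map Prod.fst) :
    Sat lab w (i + (l₁ ++ (a, t) :: l₂).length) (cLt (.histS a) c) ↔ τ - t < c := by
  simp only [cLt, Sat, clockVal_histS h h₂, exists_eq_left, not_le]
  exact ⟨fun h => h.2, fun h => ⟨h.le, h⟩⟩

theorem sat_of_timedV {k : ℕ} {X : Finset (Fin k)} {τ : ℝ} {tv w : List (Alph k × ℝ)} {i : ℕ}
    {y : Alph k} (htv : TimedV X τ tv) (h : tv ++ [(y, τ)] <+: w.drop i) {x : Fin k} :
    Sat symLab w (i + tv.length) (cLt (.histS (.e x)) 1) ↔ x ∈ X := by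
  obtain ⟨hv, h₁, h₂⟩ := htv
  have htake : (tv.take k).map Prod.fst = (List.finRange k).map Alph.e := by
    rw [List.map_take, hv, vEnc, List.take_left' (by simp)]
  have hdrop : (tv.drop k).map Prod.fst = (X.sort (· ≤ ·)).map Alph.e := by
    rw [List.map_drop, hv, vEnc, List.drop_left' (by simp)]
  have htv := (List.take_append_drop k tv).symm
  by_cases hx : x ∈ X
  · obtain ⟨l₁, t, l₂, hl, hn⟩ := exists_last_occurrence (a := Alph.e x) (l := tv.drop k)
      (by rw [hdrop]; simp [hx])
    rw [hl, ← List.append_assoc] at htv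
    have ht := h₂ (.e x, t) (by rw [hl]; simp)
    rw [htv] at h ⊢
    rw [sat_cLt h hn]
    simp only [hx, iff_true]
    linarith [ht.1]
  · obtain ⟨l₁, t, l₂, hl, hn⟩ := exists_last_occurrence (a := Alph.e x) (l := tv.take k)
      (by rw [htake]; simp)
    have ht := h₁ (.e x, t) (by rw [hl]; simp)
    rw [hl, List.append_assoc, List.cons_append] at htv
    rw [htv] at h ⊢
    rw [sat_cLt h (by
      rw [List.map_append, List.mem_append, hdrop]
      simpa [hx] using hn)]
    simp only [hx, iff_false, not_lt]
    linarith

end Clocks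

section Computations

variable {n k : ℕ} {w : List (Alph k × ℝ)}

/-- After reading `i` symbols of `w`, the automaton may hold the number `j` with the stack `γ`. -/
def Holds (w : List (Alph k × ℝ)) (i j : ℕ) (γ : List (Fin n × Fin k)) : Prop :=
  ∃ q, Live q j ∧ Reach symLab (automaton n k) w i (q, γ)

theorem reach_int {v : List (Alph k × ℝ)} {i : ℕ} (hv : ∀ z ∈ v.map Prod.fst, symLab z = .int)
    (h : v <+: w.drop i) {q' : State n} {γ : List (Fin n × Fin k)} :
    Reach symLab (automaton n k) w (i + v.length) (q', γ) ↔
      ∃ q, Run (v.map Prod.fst) q q' ∧ Reach symLab (automaton n k) w i (q, γ) := by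
  induction v generalizing i with
  | nil => simp [Run]
  | cons p v ih =>
    have hp : w[i]? = some p := by
      simpa using getElem?_of_prefix_drop h (x := 0) (by simp)
    rw [← List.singleton_append, append_prefix_drop] at h
    simp only [List.map_cons, List.mem_cons, forall_eq_or_imp] at hv
    have hs : ∀ q₁ : State n, Reach symLab (automaton n k) w (i + 1) (q₁, γ) ↔
        ∃ q, Step p.1 q q₁ ∧ Reach symLab (automaton n k) w i (q, γ) := by
      intro q₁
      constructor
      · intro hr
        cases hr with
        | int hr hp' _ _ hδ =>
          obtain rfl := Option.some.inj (hp.symm.trans hp')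
          exact ⟨_, hδ.2, hr⟩
        | call _ hp' hl =>
          obtain rfl := Option.some.inj (hp.symm.trans hp')
          simp [hv.1] at hl
        | ret _ hp' hl =>
          obtain rfl := Option.some.inj (hp.symm.trans hp')
          simp [hv.1] at hl
        | retEmpty _ hp' hl =>
          obtain rfl := Option.some.inj (hp.symm.trans hp')
          simp [hv.1] at hl
      · rintro ⟨q, hq, hr⟩
        exact .int (φ := .tt) hr hp hv.1 trivial ⟨rfl, hq⟩
    rw [List.length_cons, show i + (v.length + 1) = i + 1 + v.length by omega, ih hv.2 (by exact h.2)]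
    simp only [List.map_cons, Run, hs]
    constructor
    · rintro ⟨q₁, h₁, q, hq, hr⟩
      exact ⟨q, ⟨q₁, hq, h₁⟩, hr⟩
    · rintro ⟨q, ⟨q₁, hq, h₁⟩, hr⟩
      exact ⟨q₁, h₁, q, hq, hr⟩

theorem reach_timedV (hk : 1 ≤ k) {X : Finset (Fin k)} {τ : ℝ} {tv : List (Alph k × ℝ)} {i : ℕ}
    (htv : TimedV X τ tv) (h : tv <+: w.drop i) {x : Fin n} {γ : List (Fin n × Fin k)} :
    Reach symLab (automaton n k) w (i + tv.length) ((.keep, x), γ) ↔ Holds w i x γ := by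
  rw [reach_int _ h, htv.1]
  · simp only [run_vEnc hk, Holds, and_true]
  · rw [htv.1]
    intro z ha
    simp only [vEnc, List.mem_append, List.mem_map] at ha
    obtain ⟨_, -, rfl⟩ | ⟨_, -, rfl⟩ := ha <;> rfl

theorem holds_call (hk : 1 ≤ k) {X : Finset (Fin k)} {R : Finset (Fin n × Fin n)} {τ : ℝ}
    {tv tu : List (Alph k × ℝ)} {i j : ℕ} (htv : TimedV X τ tv)
    (htu : tu.map Prod.fst = uEnc n R) (h : tv ++ [(Alph.lt, τ)] ++ tu <+: w.drop i)
    {g : Fin n × Fin k} {γ : List (Fin n × Fin k)} :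
    Holds w (i + (tv ++ [(Alph.lt, τ)] ++ tu).length) j (g :: γ) ↔
      g.2 ∈ X ∧ (∃ y : Fin n, y.val = j ∧ (g.1, y) ∈ R) ∧ Holds w i g.1 γ := by
  rw [append_prefix_drop] at h
  obtain ⟨h, hu⟩ := h
  have hb : w[i + tv.length]? = some (.lt, τ) := by
    rw [getElem?_of_prefix_drop h (by simp)]
    simp
  have hs := fun x => sat_of_timedV htv h (x := x)
  have hv := (append_prefix_drop.1 h).1
  have hint : ∀ z ∈ tu.map Prod.fst, symLab z = .int := by
    intro z ha
    rw [htu] at ha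
    obtain rfl | rfl | rfl := mem_pairEnc (L := pairList n R) ha <;> rfl
  have hcall : ∀ q : State n,
      Reach symLab (automaton n k) w (i + tv.length + 1) (q, g :: γ) ↔
        q = (.seek, g.1) ∧ g.2 ∈ X ∧ Holds w i g.1 γ := by
    intro q
    rw [← reach_timedV hk htv hv, ← hs]
    constructor
    · intro hr
      cases hr with
      | int _ hp hl =>
        obtain rfl := Option.some.inj (hb.symm.trans hp)
        simp [symLab] at hl
      | call hr hp _ hsat hδ =>
        obtain ⟨rfl, rfl, hq⟩ := hδ
        exact ⟨hq, hsat, hr⟩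
      | ret _ hp hl =>
        obtain rfl := Option.some.inj (hb.symm.trans hp)
        simp [symLab] at hl
    · rintro ⟨rfl, hsat, hr⟩
      exact .call hr hb rfl hsat ⟨rfl, rfl, rfl⟩
  rw [List.length_append, List.length_singleton, ← add_assoc] at hu
  rw [List.length_append, ← add_assoc, ← exists_run_uEnc (k := k), Holds]
  simp only [reach_int hint hu, htu, List.length_append, List.length_singleton, ← add_assoc, hcall]
  constructor
  · rintro ⟨q, hq, _, hr, rfl, hX, hH⟩
    exact ⟨hX, ⟨q, hr, hq⟩, hH⟩
  · rintro ⟨hX, ⟨q, hr, hq⟩, hH⟩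
    exact ⟨q, hq, _, hr, rfl, hX, hH⟩

theorem holds_c {tc : List (Alph k × ℝ)} {m i j : ℕ}
    (htc : tc.map Prod.fst = List.replicate m .c) (h : tc <+: w.drop i)
    {γ : List (Fin n × Fin k)} : Holds w (i + tc.length) j γ ↔ Holds w i (m + j) γ := by
  simp only [Holds, ← run_c (k := k)]
  simp only [reach_int (v := tc) (by simp [htc, symLab]) h, htc]
  constructor
  · rintro ⟨q', hq', q, hr, h⟩
    exact ⟨q, ⟨q', hr, hq'⟩, h⟩
  · rintro ⟨q, ⟨q', hr, hq'⟩, h⟩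
    exact ⟨q', hq', q, hr, h⟩

theorem holds_ret (hk : 1 ≤ k) {Y : Finset (Fin k)} {σ : ℝ} {tw tc : List (Alph k × ℝ)}
    {m i j : ℕ} (htw : TimedV Y σ tw) (htc : tc.map Prod.fst = List.replicate m .c)
    (h : tw ++ [(Alph.gt, σ)] ++ tc <+: w.drop i) {γ : List (Fin n × Fin k)} :
    Holds w (i + (tw ++ [(Alph.gt, σ)] ++ tc).length) j γ ↔
      ∃ g : Fin n × Fin k, g.1.val = m + j ∧ g.2 ∈ Y ∧ Holds w i 0 (g :: γ) := by
  rw [append_prefix_drop] at h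
  obtain ⟨h, hc⟩ := h
  have hb : w[i + tw.length]? = some (.gt, σ) := by
    rw [getElem?_of_prefix_drop h (by simp)]
    simp
  have hs := fun x => sat_of_timedV htw h (x := x)
  have hv := (append_prefix_drop.1 h).1
  have hret : ∀ q : State n,
      Reach symLab (automaton n k) w (i + tw.length + 1) (q, γ) ↔
        ∃ g : Fin n × Fin k, q = (.keep, g.1) ∧ g.2 ∈ Y ∧ Holds w i 0 (g :: γ) := by
    intro q
    constructor
    · intro hr
      cases hr with
      | int _ hp hl =>
        obtain rfl := Option.some.inj (hb.symm.trans hp)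
        simp [symLab] at hl
      | call _ hp hl =>
        obtain rfl := Option.some.inj (hb.symm.trans hp)
        simp [symLab] at hl
      | @ret _ q₁ _ _ g _ _ hr hp _ hsat hδ =>
        obtain ⟨g', hg, rfl, hq, hq', rfl⟩ := hδ
        obtain rfl := Option.some.inj hg
        obtain ⟨p, x⟩ := q₁
        obtain rfl : p = .keep := hq
        rw [reach_timedV hk htw hv] at hr
        exact ⟨_, rfl, (hs _).1 hsat, hq' ▸ hr⟩
      | retEmpty _ _ _ _ hδ =>
        obtain ⟨g', hg, -⟩ := hδ
        cases hg
    · rintro ⟨g, rfl, hY, hH⟩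
      have hn : 0 < n := g.1.pos
      exact .ret ((reach_timedV hk htw hv (x := ⟨0, hn⟩)).2 hH) hb rfl ((hs _).2 hY)
        ⟨g, rfl, rfl, rfl, rfl, rfl⟩
  rw [List.length_append, ← add_assoc, holds_c htc hc, Holds, List.length_append,
    List.length_singleton, ← add_assoc]
  simp only [hret]
  constructor
  · rintro ⟨q, hq, g, rfl, hY, hH⟩
    exact ⟨g, live_keep.1 hq, hY, hH⟩
  · rintro ⟨g, hg, hY, hH⟩
    exact ⟨_, live_keep.2 hg, g, rfl, hY, hH⟩

theorem holds_iff_valid (hk : 1 ≤ k) {m : ℕ} {s : Fin (m + 1) → Fin n}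
    {R : Fin m → Finset (Fin n × Fin n)} {X Y : Fin m → Finset (Fin k)}
    {tv tu tw : Fin m → List (Alph k × ℝ)} {tc : Fin (m + 1) → List (Alph k × ℝ)}
    {τ σ : Fin m → ℝ} (htv : ∀ i, TimedV (X i) (τ i) (tv i))
    (htu : ∀ i, (tu i).map Prod.fst = uEnc n (R i)) (htw : ∀ i, TimedV (Y i) (σ i) (tw i))
    (htc : ∀ j, (tc j).map Prod.fst = List.replicate ((s j : ℕ)) Alph.c)
    {v : List (Alph k × ℝ)}
    (hv : v = ((List.finRange m).flatMap fun i => tv i ++ [(Alph.lt, τ i)] ++ tu i)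
        ++ tc (Fin.last m)
        ++ ((List.finRange m).reverse.flatMap fun i =>
              tw i ++ [(Alph.gt, σ i)] ++ tc i.castSucc))
    {i : ℕ} (h : v <+: w.drop i) {γ : List (Fin n × Fin k)} :
    Holds w (i + v.length) 0 γ ↔ Holds w i (s 0) γ ∧
      (∀ l : Fin m, (s l.castSucc, s l.succ) ∈ R l) ∧ ∀ l : Fin m, (X l ∩ Y l).Nonempty := by
  induction m generalizing v i γ with
  | zero =>
    obtain rfl : v = tc 0 := by simpa using hv
    simpa using holds_c (j := 0) (htc 0) h
  | succ m ih =>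
    set v' : List (Alph k × ℝ) :=
      ((List.finRange m).flatMap fun i =>
          tv i.succ ++ [(Alph.lt, τ i.succ)] ++ tu i.succ)
        ++ tc (Fin.last m).succ
        ++ ((List.finRange m).reverse.flatMap fun i =>
              tw i.succ ++ [(Alph.gt, σ i.succ)] ++ tc i.castSucc.succ) with hv'
    have hsplit : v = (tv 0 ++ [(Alph.lt, τ 0)] ++ tu 0) ++ v' ++
        (tw 0 ++ [(Alph.gt, σ 0)] ++ tc 0) := by
      rw [hv, hv', List.finRange_succ]
      simp [List.flatMap_map, ← List.map_reverse]
    rw [hsplit, append_prefix_drop, append_prefix_drop] at h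
    obtain ⟨⟨h₁, h₂⟩, h₃⟩ := h
    rw [hsplit, List.length_append, ← add_assoc, holds_ret hk (htw 0) (htc 0) h₃]
    have key := fun (g : Fin n × Fin k) => ih (s := fun l => s l.succ) (fun l => htv l.succ)
      (fun l => htu l.succ) (fun l => htw l.succ) (fun l => htc l.succ) hv' h₂
      (γ := g :: γ)
    rw [List.length_append, ← add_assoc]
    simp only [key, holds_call hk (htv 0) (htu 0) h₁, Fin.forall_fin_succ]
    constructor
    · rintro ⟨g, hg, hY, ⟨hX, ⟨y, hy, hR⟩, hH⟩, hR', hXY⟩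
      obtain rfl : y = s (Fin.succ 0) := Fin.ext hy
      obtain hg : g.1 = s 0 := Fin.ext hg
      rw [hg] at hR hH
      exact ⟨hH, ⟨hR, hR'⟩, ⟨g.2, Finset.mem_inter.2 ⟨hX, hY⟩⟩, hXY⟩
    · rintro ⟨hH, ⟨hR, hR'⟩, ⟨x, hx⟩, hXY⟩
      obtain ⟨hX, hY⟩ := Finset.mem_inter.1 hx
      exact ⟨(s 0, x), rfl, hY, ⟨hX, ⟨_, rfl, hR⟩, hH⟩, hR', hXY⟩

theorem accepts_iff_valid (hk : 1 ≤ k) {d : WFData n k} (h : Realizes d w) :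
    (automaton n k).Accepts symLab w ↔ d.Valid := by
  obtain ⟨-, tv, tu, tw, tc, τ, σ, htv, htu, htw, htc, hw⟩ := h
  have key := fun γ => holds_iff_valid hk htv htu htw htc hw (i := 0) (w := w) (by simp) (γ := γ)
  have hstart : Holds w 0 (d.s 0 : ℕ) ([] : List (Fin n × Fin k)) :=
    ⟨(.keep, d.s 0), by simp, .start rfl⟩
  have hacc : (automaton n k).Accepts symLab w ↔
      ∃ γ : List (Fin n × Fin k), Holds w (0 + w.length) 0 γ := by
    rw [zero_add]
    constructor
    · rintro ⟨q, γ, h, hq⟩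
      exact ⟨γ, q, hq, h⟩
    · rintro ⟨γ, q, hq, h⟩
      exact ⟨q, γ, h, hq⟩
  simp only [hacc, key]
  constructor
  · rintro ⟨γ, -, h⟩
    exact h
  · intro h
    exact ⟨[], hstart, h⟩

end Computations

theorem card_state (n : ℕ) : Nat.card (State n) = 4 * n := by
  rw [Nat.card_prod, Nat.card_eq_fintype_card, Nat.card_fin]
  rfl

theorem used_automaton_subset (n k : ℕ) : (automaton n k).used ⊆
    insert .tt (Set.range fun i : Fin k => cLt (.histS (.e i)) 1) := by
  rintro φ (⟨z, q, q', rfl, -⟩ | ⟨z, q, r, rfl, -⟩ | ⟨z, g, q, q', s, -, rfl, -⟩)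
  · exact .inl rfl
  · exact .inr ⟨_, rfl⟩
  · exact .inr ⟨_, rfl⟩

theorem ncard_range_cLt (k : ℕ) :
    (Set.range fun i : Fin k => cLt (Clock.histS (Alph.e i)) 1).ncard = k := by
  rw [← Set.image_univ, Set.ncard_image_of_injective, Set.ncard_univ, Nat.card_fin]
  intro i j h
  simpa [cLt] using h

end LowerBoundAutomaton

/-- **The nondeterministic automaton for the lower bound.**
There is an absolute constant `C` (independent of `n` and `k`) such
that for all `n, k ≥ 1` there exists a nondeterministic event-clock
input-driven pushdown automaton with at most `C·n` states, `n·k` stack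
symbols (the pairs `(s, e)` with `s ∈ {0,…,n−1}` and
`e ∈ {e₁,…,e_k}`), and `k` atomic clock constraints, each of the form
`◁e_i < 1` for a symbol history clock, which accepts every valid
well-formed timed string and does not accept any invalid well-formed
timed string. -/
theorem lower_bound_nondeterministic_automaton :
    ∃ C : ℕ, ∀ n k : ℕ, 1 ≤ n → 1 ≤ k →
      ∃ (Q : Type) (_ : Finite Q), Nat.card Q ≤ C * n ∧
      ∃ M : ECIDPDA (Alph k) Q (Fin n × Fin k),
        M.used ⊆ insert ClockConstraint.tt
          (Set.range fun i : Fin k => cLt (Clock.histS (Alph.e i)) 1) ∧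
        (Set.range fun i : Fin k => cLt (Clock.histS (Alph.e i)) 1).ncard = k ∧
        ∀ (d : WFData n k) (w : List (Alph k × ℝ)), Realizes d w →
          (d.Valid → ECIDPDA.Accepts symLab M w) ∧
          (¬ d.Valid → ¬ ECIDPDA.Accepts symLab M w) := by
  refine ⟨4, fun n k _ hk => ⟨LowerBoundAutomaton.State n, inferInstance,
    (LowerBoundAutomaton.card_state n).le, LowerBoundAutomaton.automaton n k,
    LowerBoundAutomaton.used_automaton_subset n k, LowerBoundAutomaton.ncard_range_cLt k,
    fun d w h => ?_⟩⟩
  rw [LowerBoundAutomaton.accepts_iff_valid hk h]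
  exact ⟨id, id⟩
end
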